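/- arXiv:2010.11914 — 2 statements merged into one kernel-verified Lean document; each statement's English description precedes it below -/
import Mathlib

section
/- Let N be a finite set, let B ⊆ A_N be a set of at most two CI statements, and let G be a minimal gaussoid extension of B, i.e. a gaussoid over N containing B that is inclusion-minimal among gaussoids containing B. Then for every real ε > 0 there exists a symmetric positive-definite matrix Σ with rational entries, rows and columns indexed by N, such that CIS(Σ) = G and |Σ_{ab} − I_{ab}| < ε for all a, b ∈ N, where I denotes the identity matrix. -/
open scoped symmDiff

abbrev CIStmt (N : Type*) := Sym2 N × Finset N

def CIStmt.proper {N : Type*} (s : CIStmt N) : Prop :=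
  ¬ s.1.IsDiag ∧ ∀ i ∈ s.1, i ∉ s.2

variable {N : Type*} [DecidableEq N]

def pminor {R : Type*} [CommRing R] (M : Matrix N N R) (S : Finset N) : R :=
  (M.submatrix (fun a : S => (a : N)) (fun a : S => (a : N))).det

def apminor {R : Type*} [CommRing R] (M : Matrix N N R) (i j : N) (K : Finset N) : R :=
  (Matrix.of fun a b : Unit ⊕ ↥K =>
      M (Sum.elim (fun _ => i) (fun k => (k : N)) a)
        (Sum.elim (fun _ => j) (fun k => (k : N)) b)).det

def PrinReg {R : Type*} [CommRing R] (M : Matrix N N R) : Prop :=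
  ∀ S : Finset N, pminor M S ≠ 0

def PosDefMinors {R : Type*} [Field R] [LinearOrder R] [IsStrictOrderedRing R] (M : Matrix N N R) : Prop :=
  ∀ S : Finset N, 0 < pminor M S

def CIS {R : Type*} [CommRing R] (M : Matrix N N R) : Set (CIStmt N) :=
  {s | s.proper ∧ ∀ i j : N, s.1 = s(i, j) → apminor M i j s.2 = 0}

def IsGaussoid (G : Set (CIStmt N)) : Prop :=
  (∀ s ∈ G, s.proper) ∧
  ∀ i j k : N, ∀ L : Finset N,
    i ≠ j → i ≠ k → j ≠ k → i ∉ L → j ∉ L → k ∉ L →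
      (((s(i,j), L) ∈ G ∧ (s(i,k), insert j L) ∈ G) ↔
        ((s(i,k), L) ∈ G ∧ (s(i,j), insert k L) ∈ G)) ∧
      (((s(i,j), insert k L) ∈ G ∧ (s(i,k), insert j L) ∈ G) ↔
        ((s(i,j), L) ∈ G ∧ (s(i,k), L) ∈ G)) ∧
      (((s(i,j), L) ∈ G ∧ (s(i,j), insert k L) ∈ G) →
        ((s(i,k), L) ∈ G ∨ (s(j,k), L) ∈ G))



namespace GP

lemma sum_unit_finset {N : Type*} [Fintype N] [DecidableEq N] (f : N → ℚ) (j : N) (K : Finset N)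
    (hj : j ∉ K) (h0 : ∀ m, m ∉ K → m ≠ j → f m = 0) :
    ∑ m, f m = f j + ∑ m : K, f m := by
  rw [Finset.sum_coe_sort K f, ← Finset.sum_insert hj]
  symm
  apply Finset.sum_subset (Finset.subset_univ _)
  intro m _ hm
  simp only [Finset.mem_insert, not_or] at hm
  exact h0 m hm.2 hm.1

lemma apminor_eq {N : Type*} [DecidableEq N] {R : Type*} [CommRing R] (S : Matrix N N R)
    (i j : N) (K : Finset N) : apminor S i j K =
    (Matrix.of fun a b : Unit ⊕ ↥K =>
      S (Sum.elim (fun _ => i) (fun k : K => (k : N)) a)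
        (Sum.elim (fun _ => j) (fun k : K => (k : N)) b)).det := by
  unfold apminor
  congr 1
  ext a b
  rcases a with a | a <;> rcases b with b | b <;> rfl

/-- Existence of a kernel vector for the almost-principal submatrix. -/
def Sing {N : Type*} [Fintype N] (S : Matrix N N ℚ) (i j : N) (K : Finset N) : Prop :=
  ∃ x : N → ℚ, x ≠ 0 ∧ (∀ m, m ∉ K → m ≠ j → x m = 0) ∧ S.mulVec x i = 0 ∧
    ∀ m ∈ K, S.mulVec x m = 0

lemma apminor_eq_zero_iff {N : Type*} [Fintype N] [DecidableEq N] (S : Matrix N N ℚ) (i j : N)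
    (K : Finset N) (hj : j ∉ K) : apminor S i j K = 0 ↔ Sing S i j K := by
  rw [apminor_eq]
  rw [← Matrix.exists_mulVec_eq_zero_iff]
  constructor
  · rintro ⟨v, hv, h⟩
    set x : N → ℚ := fun m => if m = j then v (Sum.inl ()) else
      if h : m ∈ K then v (Sum.inr ⟨m, h⟩) else 0 with hx
    have hxj : x j = v (Sum.inl ()) := by simp [hx]
    have hxK : ∀ m : K, x m = v (Sum.inr m) := by
      intro m
      have : (m : N) ≠ j := fun h => hj (h ▸ m.2)
      simp [hx, this]
    have hx0 : ∀ m, m ∉ K → m ≠ j → x m = 0 := by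
      intro m h1 h2
      simp [hx, h1, h2]
    have key : ∀ a, S.mulVec x a = S a j * x j + ∑ m : K, S a m * x m := by
      intro a
      exact sum_unit_finset (fun m => S a m * x m) j K hj
        (fun m h1 h2 => by simp [hx0 m h1 h2])
    refine ⟨x, ?_, hx0, ?_, ?_⟩
    · intro h0
      apply hv
      funext a
      rcases a with a | a
      · rw [← hxj, h0]; rfl
      · rw [← hxK, h0]; rfl
    · have := congrFun h (Sum.inl ())
      rw [key, hxj]
      simp only [hxK]
      simpa [Matrix.mulVec, dotProduct, Fintype.sum_sum_type] using this
    · intro m hm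
      have := congrFun h (Sum.inr ⟨m, hm⟩)
      rw [key, hxj]
      simp only [hxK]
      simpa [Matrix.mulVec, dotProduct, Fintype.sum_sum_type] using this
  · rintro ⟨x, hx, hx0, hi, hK⟩
    have key : ∀ a, S.mulVec x a = S a j * x j + ∑ m : K, S a m * x m := by
      intro a
      exact sum_unit_finset (fun m => S a m * x m) j K hj
        (fun m h1 h2 => by simp [hx0 m h1 h2])
    refine ⟨Sum.elim (fun _ => x j) (fun k => x k), ?_, ?_⟩
    · intro h0
      apply hx
      funext m
      by_cases h1 : m = j
      · have := congrFun h0 (Sum.inl ())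
        simpa [h1] using this
      · by_cases h2 : m ∈ K
        · have := congrFun h0 (Sum.inr ⟨m, h2⟩)
          simpa using this
        · exact hx0 m h2 h1
    · funext a
      rcases a with a | a
      · rw [key] at hi
        simpa [Matrix.mulVec, dotProduct, Fintype.sum_sum_type] using hi
      · have := hK a a.2
        rw [key] at this
        simpa [Matrix.mulVec, dotProduct, Fintype.sum_sum_type] using this

lemma apminor_comm {N : Type*} [DecidableEq N] {R : Type*} [CommRing R] (S : Matrix N N R)
    (hS : S.IsSymm) (i j : N) (K : Finset N) : apminor S i j K = apminor S j i K := by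
  unfold apminor
  rw [← Matrix.det_transpose]
  congr 1
  ext a b
  simp only [Matrix.transpose_apply, Matrix.of_apply]
  exact hS.apply _ _

lemma Sing_comm {N : Type*} [Fintype N] [DecidableEq N] (S : Matrix N N ℚ)
    (hS : S.IsSymm) (i j : N) (K : Finset N) (hi : i ∉ K) (hj : j ∉ K) :
    Sing S i j K ↔ Sing S j i K := by
  rw [← apminor_eq_zero_iff S i j K hj, ← apminor_eq_zero_iff S j i K hi, apminor_comm S hS]

lemma apminor_map {N : Type*} [DecidableEq N] {R R' : Type*} [CommRing R] [CommRing R']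
    (f : R →+* R') (S : Matrix N N R) (i j : N) (K : Finset N) :
    apminor (S.map f) i j K = f (apminor S i j K) := by
  unfold apminor
  rw [RingHom.map_det]
  rfl

/-! ### Pivoting -/

def UU {N : Type*} [DecidableEq N] (Z : Finset N) (S : Matrix N N ℚ) : Matrix N N ℚ :=
  Matrix.of fun a b => if a ∈ Z then (1 : Matrix N N ℚ) a b else S a b

def WW {N : Type*} [DecidableEq N] (Z : Finset N) (S : Matrix N N ℚ) : Matrix N N ℚ :=
  Matrix.of fun a b => if a ∈ Z then - S a b else (1 : Matrix N N ℚ) a b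

def JJ {N : Type*} [DecidableEq N] (Z : Finset N) (a : N) : ℚ := if a ∈ Z then -1 else 1

lemma UU_mulVec {N : Type*} [Fintype N] [DecidableEq N] (Z : Finset N) (S : Matrix N N ℚ)
    (x : N → ℚ) (a : N) : (UU Z S).mulVec x a = if a ∈ Z then x a else S.mulVec x a := by
  unfold UU
  by_cases h : a ∈ Z <;> simp [Matrix.mulVec, dotProduct, h, Matrix.one_apply]

lemma WW_mulVec {N : Type*} [Fintype N] [DecidableEq N] (Z : Finset N) (S : Matrix N N ℚ)
    (x : N → ℚ) (a : N) : (WW Z S).mulVec x a = if a ∈ Z then - S.mulVec x a else x a := by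
  unfold WW
  by_cases h : a ∈ Z <;> simp [Matrix.mulVec, dotProduct, h, Matrix.one_apply]

lemma WU_symm {N : Type*} [Fintype N] [DecidableEq N] (Z : Finset N) (S : Matrix N N ℚ)
    (hS : S.IsSymm) : (WW Z S).transpose * UU Z S = (UU Z S).transpose * WW Z S := by
  ext a b
  simp only [Matrix.mul_apply, Matrix.transpose_apply]
  have h1 : ∀ c, WW Z S c a * UU Z S c b =
      (if c = b then (if c ∈ Z then - S c a else 0) else 0) +
      (if c = a then (if c ∈ Z then 0 else S c b) else 0) := by
    intro c
    unfold WW UU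
    by_cases h : c ∈ Z <;> simp [h, Matrix.one_apply]
  have h2 : ∀ c, UU Z S c a * WW Z S c b =
      (if c = a then (if c ∈ Z then - S c b else 0) else 0) +
      (if c = b then (if c ∈ Z then 0 else S c a) else 0) := by
    intro c
    unfold WW UU
    by_cases h : c ∈ Z <;> simp [h, Matrix.one_apply, neg_ite]
  simp only [h1, h2, Finset.sum_add_distrib, Finset.sum_ite_eq', Finset.mem_univ, if_true]
  have := hS.apply a b
  split_ifs <;> linarith

noncomputable def piv {N : Type*} [Fintype N] [DecidableEq N] (Z : Finset N) (S : Matrix N N ℚ) :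
    Matrix N N ℚ := UU Z S * (WW Z S)⁻¹

lemma piv_symm {N : Type*} [Fintype N] [DecidableEq N] (Z : Finset N) (S : Matrix N N ℚ)
    (hS : S.IsSymm) (hW : (WW Z S).det ≠ 0) : (piv Z S).IsSymm := by
  have hu : IsUnit (WW Z S).det := hW.isUnit
  have hut : IsUnit (WW Z S).transpose.det := by rwa [Matrix.det_transpose]
  unfold Matrix.IsSymm piv
  rw [Matrix.transpose_mul, Matrix.transpose_nonsing_inv]
  calc (WW Z S).transpose⁻¹ * (UU Z S).transpose
      = (WW Z S).transpose⁻¹ * ((UU Z S).transpose * WW Z S) * (WW Z S)⁻¹ := by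
        rw [Matrix.mul_assoc, Matrix.mul_assoc, Matrix.mul_nonsing_inv _ hu, Matrix.mul_one]
    _ = (WW Z S).transpose⁻¹ * ((WW Z S).transpose * UU Z S) * (WW Z S)⁻¹ := by
        rw [WU_symm Z S hS]
    _ = UU Z S * (WW Z S)⁻¹ := by
        rw [← Matrix.mul_assoc, Matrix.nonsing_inv_mul _ hut, Matrix.one_mul]

/-- the pivoted conditioning set -/
def pset {N : Type*} [DecidableEq N] (Z : Finset N) (i j : N) (L : Finset N) : Finset N :=
  ((L ∆ Z).erase i).erase j

lemma mem_pset {N : Type*} [DecidableEq N] (Z : Finset N) (i j : N) (L : Finset N) (m : N) :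
    m ∈ pset Z i j L ↔ m ≠ i ∧ m ≠ j ∧ ((m ∈ L ∧ m ∉ Z) ∨ (m ∈ Z ∧ m ∉ L)) := by
  simp only [pset, Finset.mem_erase, Finset.mem_symmDiff]
  tauto

lemma piv_Sing {N : Type*} [Fintype N] [DecidableEq N] (Z : Finset N) (S : Matrix N N ℚ)
    (hW : (WW Z S).det ≠ 0) (i j : N) (L : Finset N) (hij : i ≠ j) (hi : i ∉ L) (hj : j ∉ L) :
    Sing (piv Z S) i j L ↔ Sing S i j (pset Z i j L) := by
  have hu : IsUnit (WW Z S).det := hW.isUnit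
  have hinv : (WW Z S)⁻¹ * WW Z S = 1 := Matrix.nonsing_inv_mul _ hu
  have hinv' : WW Z S * (WW Z S)⁻¹ = 1 := Matrix.mul_nonsing_inv _ hu
  have key : ∀ x x' : N → ℚ, x = (WW Z S).mulVec x' → (x ≠ 0 ↔ x' ≠ 0) →
      ((x ≠ 0 ∧ (∀ m, m ∉ L → m ≠ j → x m = 0) ∧ (piv Z S).mulVec x i = 0 ∧
        ∀ m ∈ L, (piv Z S).mulVec x m = 0) ↔
       (x' ≠ 0 ∧ (∀ m, m ∉ pset Z i j L → m ≠ j → x' m = 0) ∧ S.mulVec x' i = 0 ∧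
        ∀ m ∈ pset Z i j L, S.mulVec x' m = 0)) := by
    intro x x' hx hne
    have hy : (piv Z S).mulVec x = (UU Z S).mulVec x' := by
      rw [hx, piv, Matrix.mulVec_mulVec, Matrix.mul_assoc, hinv, Matrix.mul_one]
    rw [hy, hne]
    have e1 : ∀ m, x m = if m ∈ Z then - S.mulVec x' m else x' m := by
      intro m; rw [hx, WW_mulVec]
    have e2 : ∀ m, (UU Z S).mulVec x' m = if m ∈ Z then x' m else S.mulVec x' m := by
      intro m; rw [UU_mulVec]
    simp only [e1, e2, mem_pset]
    refine and_congr_right fun _ => ?_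
    constructor
    · rintro ⟨h1, h2, h3⟩
      refine ⟨?_, ?_, ?_⟩
      · intro m hm hmj
        have a1 := h1 m
        have a2 := h3 m
        by_cases hmi : m = i
        · subst hmi
          have a1 := h1 m hi hij
          grind
        · grind
      · have a1 := h1 i hi hij
        grind
      · intro m hm
        have a1 := h1 m
        have a2 := h3 m
        grind
    · rintro ⟨h1, h2, h3⟩
      have hi' := h1 i (by simp) hij
      refine ⟨?_, ?_, ?_⟩
      · intro m hm hmj
        have a1 := h1 m
        have a2 := h3 m
        by_cases hmi : m = i
        · subst hmi
          grind
        · grind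
      · grind
      · intro m hm
        have a1 := h1 m
        have a2 := h3 m
        grind
  constructor
  · rintro ⟨x, hx⟩
    refine ⟨(WW Z S)⁻¹.mulVec x, (key x _ ?_ ?_).1 hx⟩
    · rw [Matrix.mulVec_mulVec, hinv', Matrix.one_mulVec]
    · refine not_congr ⟨fun h => by rw [h, Matrix.mulVec_zero], fun h => ?_⟩
      have : (WW Z S).mulVec ((WW Z S)⁻¹.mulVec x) = 0 := by rw [h, Matrix.mulVec_zero]
      rwa [Matrix.mulVec_mulVec, hinv', Matrix.one_mulVec] at this
  · rintro ⟨x, hx⟩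
    refine ⟨(WW Z S).mulVec x, (key _ x rfl ?_).2 hx⟩
    refine not_congr ⟨fun h => ?_, fun h => by rw [h, Matrix.mulVec_zero]⟩
    have : (WW Z S)⁻¹.mulVec ((WW Z S).mulVec x) = 0 := by rw [h, Matrix.mulVec_zero]
    rwa [Matrix.mulVec_mulVec, hinv, Matrix.one_mulVec] at this


/-! ### The genericity argument -/

noncomputable def ev {N P : Type*} (M : Matrix N N (MvPolynomial P ℚ)) (p : P → ℚ) :
    Matrix N N ℚ := M.map (MvPolynomial.eval p)

lemma WW_J {N : Type*} [DecidableEq N] (Z : Finset N) :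
    WW Z (Matrix.diagonal (JJ Z)) = 1 := by
  ext a b
  by_cases hab : a = b
  · subst hab
    by_cases h : a ∈ Z <;> simp [WW, JJ, h]
  · by_cases h : a ∈ Z <;> simp [WW, h, hab, Matrix.diagonal_apply, Matrix.one_apply]

lemma UU_J {N : Type*} [DecidableEq N] (Z : Finset N) :
    UU Z (Matrix.diagonal (JJ Z)) = 1 := by
  ext a b
  by_cases hab : a = b
  · subst hab
    by_cases h : a ∈ Z <;> simp [UU, JJ, h]
  · by_cases h : a ∈ Z <;> simp [UU, h, hab, Matrix.diagonal_apply, Matrix.one_apply]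

lemma piv_continuousAt {N : Type*} [Fintype N] [DecidableEq N] (Z : Finset N) :
    ContinuousAt (piv Z) (Matrix.diagonal (JJ Z)) := by
  unfold piv
  have hU : Continuous (UU Z) := by
    refine continuous_matrix fun a b => ?_
    unfold UU
    by_cases h : a ∈ Z
    · simp [h, continuous_const]
    · simpa [h] using (continuous_id.matrix_elem a b)
  have hW : Continuous (WW Z) := by
    refine continuous_matrix fun a b => ?_
    unfold WW
    by_cases h : a ∈ Z
    · simp only [h, if_true, Matrix.of_apply]
      exact continuous_neg.comp (continuous_id.matrix_elem a b)
    · simp [h, continuous_const]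
  refine ContinuousAt.mul hU.continuousAt ?_
  refine ContinuousAt.comp (g := fun A : Matrix N N ℚ => A⁻¹) ?_ hW.continuousAt
  apply continuousAt_matrix_inv
  rw [WW_J, Matrix.det_one]
  have : (Ring.inverse : ℚ → ℚ) = fun x => x⁻¹ := by
    funext x; exact Ring.inverse_eq_inv x
  rw [this]
  exact continuousAt_inv₀ one_ne_zero

lemma piv_J {N : Type*} [Fintype N] [DecidableEq N] (Z : Finset N) :
    piv Z (Matrix.diagonal (JJ Z)) = 1 := by
  rw [piv, UU_J, WW_J, inv_one, mul_one]

lemma exists_small {P : Type*} [Fintype P] (F : MvPolynomial P ℚ) (hF : F ≠ 0)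
    (s : Set (P → ℚ)) (hs : s ∈ nhds (0 : P → ℚ)) : ∃ p ∈ s, MvPolynomial.eval p F ≠ 0 := by
  obtain ⟨δ, hδ, hb⟩ := Metric.mem_nhds_iff.1 hs
  by_contra! hcon
  apply hF
  apply MvPolynomial.funext_set (fun _ => Metric.ball (0 : ℚ) δ)
  · intro _
    exact infinite_of_mem_nhds (0 : ℚ) (Metric.ball_mem_nhds _ hδ)
  · intro x hx
    rw [map_zero]
    apply hcon
    apply hb
    rw [Metric.mem_ball, dist_pi_lt_iff hδ]
    intro b
    exact hx b (Set.mem_univ _)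

theorem realize {N P : Type*} [Fintype N] [DecidableEq N] [Fintype P] (Z : Finset N)
    (M : Matrix N N (MvPolynomial P ℚ)) (hsym : ∀ p, (ev M p).IsSymm)
    (h0 : ev M 0 = Matrix.diagonal (JJ Z)) (G : Set (CIStmt N)) (hGp : ∀ s ∈ G, s.proper)
    (h1 : ∀ i j L, i ≠ j → i ∉ L → j ∉ L → (s(i,j), L) ∈ G →
      ∀ p, Sing (ev M p) i j (pset Z i j L))
    (h2 : ∀ i j L, i ≠ j → i ∉ L → j ∉ L → (s(i,j), L) ∉ G →
      ∃ p, ¬ Sing (ev M p) i j (pset Z i j L)) :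
    ∀ ε : ℝ, 0 < ε →
      ∃ Sig : Matrix N N ℚ, Sig.IsSymm ∧ PosDefMinors Sig ∧ CIS Sig = G ∧
        ∀ a b : N, |((Sig a b : ℝ)) - (1 : Matrix N N ℝ) a b| < ε := by
  classical
  intro ε hε
  set F : MvPolynomial P ℚ := ∏ u : N × N × Finset N,
    if apminor M u.1 u.2.1 u.2.2 = 0 then 1 else apminor M u.1 u.2.1 u.2.2 with hFdef
  have hF : F ≠ 0 := by
    rw [hFdef, Finset.prod_ne_zero_iff]
    intro u _
    split_ifs with h
    · exact one_ne_zero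
    · exact h
  have hevc : Continuous (ev M) := by
    refine continuous_matrix fun a b => ?_
    exact MvPolynomial.continuous_eval (M a b)
  have hpc : ContinuousAt (fun p => piv Z (ev M p)) 0 := by
    apply ContinuousAt.comp (g := piv Z)
    · rw [h0]; exact piv_continuousAt Z
    · exact hevc.continuousAt
  have hp0 : piv Z (ev M 0) = 1 := by rw [h0, piv_J]
  have e1 : ∀ᶠ p in nhds (0 : P → ℚ), (WW Z (ev M p)).det ≠ 0 := by
    have hW : Continuous (WW Z) := by
      refine continuous_matrix fun a b => ?_
      unfold WW
      by_cases h : a ∈ Z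
      · simp only [h, if_true, Matrix.of_apply]
        exact continuous_neg.comp (continuous_id.matrix_elem a b)
      · simp [h, continuous_const]
    have : ContinuousAt (fun p => (WW Z (ev M p)).det) 0 :=
      (hW.comp hevc).matrix_det.continuousAt
    apply this.eventually_ne
    rw [h0, WW_J, Matrix.det_one]
    exact one_ne_zero
  have e2 : ∀ᶠ p in nhds (0 : P → ℚ), ∀ T : Finset N, 0 < pminor (piv Z (ev M p)) T := by
    rw [Filter.eventually_all]
    intro T
    have hc : Continuous (fun S : Matrix N N ℚ => pminor S T) := by
      unfold pminor
      exact (continuous_id.matrix_submatrix _ _).matrix_det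
    have : ContinuousAt (fun p => pminor (piv Z (ev M p)) T) 0 :=
      hc.continuousAt.comp hpc
    apply this.eventually (p := fun q => 0 < q)
    have : pminor (piv Z (ev M 0)) T = 1 := by
      rw [hp0, pminor, Matrix.submatrix_one _ Subtype.val_injective, Matrix.det_one]
    beta_reduce
    rw [this]
    exact lt_mem_nhds one_pos
  have e3 : ∀ᶠ p in nhds (0 : P → ℚ), ∀ a b : N,
      |(((piv Z (ev M p)) a b : ℚ) : ℝ) - (1 : Matrix N N ℝ) a b| < ε := by
    rw [Filter.eventually_all]
    intro a
    rw [Filter.eventually_all]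
    intro b
    have hc : Continuous (fun S : Matrix N N ℚ => |((S a b : ℚ) : ℝ) - (1 : Matrix N N ℝ) a b|) := by
      have h3 : Continuous (fun S : Matrix N N ℚ => ((S a b : ℚ) : ℝ)) :=
        Rat.continuous_coe_real.comp (continuous_id.matrix_elem a b)
      exact (h3.sub continuous_const).abs
    have : ContinuousAt (fun p => |(((piv Z (ev M p)) a b : ℚ) : ℝ) - (1 : Matrix N N ℝ) a b|) 0 :=
      hc.continuousAt.comp hpc
    apply this.eventually (p := fun q => q < ε)
    apply gt_mem_nhds
    beta_reduce
    rw [hp0]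
    by_cases hab : a = b <;> simp [Matrix.one_apply, hab, hε]
  obtain ⟨p, ⟨hp1, hp2, hp3⟩, hpF⟩ := exists_small F hF _ (e1.and (e2.and e3))
  refine ⟨piv Z (ev M p), piv_symm Z _ (hsym p) hp1, hp2, ?_, hp3⟩
  have key : ∀ i j L, j ∉ L → (∃ q, ¬ Sing (ev M q) i j L) → ¬ Sing (ev M p) i j L := by
    rintro i j L hj ⟨q, hq⟩
    rw [← apminor_eq_zero_iff _ _ _ _ hj, ev, apminor_map] at hq ⊢
    have hne : apminor M i j L ≠ 0 := by
      intro h; rw [h, map_zero] at hq; exact hq rfl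
    rw [hFdef, map_prod, Finset.prod_ne_zero_iff] at hpF
    have := hpF (i, j, L) (Finset.mem_univ _)
    simpa [hne] using this
  ext ⟨u, L⟩
  induction u using Sym2.ind with
  | _ i j =>
  constructor
  · rintro ⟨hprop, h⟩
    by_contra hnot
    have hij : i ≠ j := by
      have := hprop.1; simpa using this
    have hi : i ∉ L := hprop.2 i (by simp)
    have hj : j ∉ L := hprop.2 j (by simp)
    have := h i j rfl
    rw [apminor_eq_zero_iff _ _ _ _ hj, piv_Sing Z _ hp1 i j L hij hi hj] at this
    exact key i j _ (by simp [pset]) (h2 i j L hij hi hj hnot) this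
  · intro hG
    refine ⟨hGp _ hG, ?_⟩
    intro i' j' he
    have hprop := hGp _ hG
    simp only at he
    rw [he] at hG hprop
    have hij : i' ≠ j' := by
      have := hprop.1; simpa using this
    have hi : i' ∉ L := hprop.2 i' (by simp)
    have hj : j' ∉ L := hprop.2 j' (by simp)
    rw [apminor_eq_zero_iff _ _ _ _ hj, piv_Sing Z _ hp1 i' j' L hij hi hj]
    exact h1 i' j' L hij hi hj hG p


/-! ### Polynomial families of symmetric matrices -/

/-- parameters: edges, regression coefficients, skew-symmetric matrix -/
abbrev PP (N : Type*) := Sym2 N ⊕ N ⊕ (N × N)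

noncomputable def FE {N : Type*} [DecidableEq N] (Z : Finset N) (F : Finset (Sym2 N)) :
    Matrix N N (MvPolynomial (PP N) ℚ) :=
  Matrix.of fun a b => if a = b then MvPolynomial.C (JJ Z a) else
    if s(a, b) ∈ F then 0 else MvPolynomial.X (Sum.inl s(a, b))

lemma ev_FE {N : Type*} [DecidableEq N] (Z : Finset N) (F : Finset (Sym2 N)) (p : PP N → ℚ)
    (a b : N) : MvPolynomial.eval p (FE Z F a b) = if a = b then JJ Z a else
      if s(a, b) ∈ F then 0 else p (Sum.inl s(a, b)) := by
  simp only [FE, Matrix.of_apply]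
  split_ifs <;> simp

def edgeFun {N : Type*} (S : Matrix N N ℚ) (hS : S.IsSymm) : Sym2 N → ℚ :=
  Sym2.lift ⟨fun a b => S a b, fun a b => (hS.apply b a)⟩

lemma ev_FE_edge {N : Type*} [DecidableEq N] (Z : Finset N) (F : Finset (Sym2 N))
    (S : Matrix N N ℚ) (hS : S.IsSymm) (hd : ∀ a, S a a = JJ Z a)
    (hF : ∀ a b, s(a, b) ∈ F → S a b = 0) (q : N ⊕ (N × N) → ℚ) (a b : N) :
    MvPolynomial.eval (Sum.elim (edgeFun S hS) q) (FE Z F a b) = S a b := by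
  rw [ev_FE]
  split_ifs with h1 h2
  · subst h1; exact (hd a).symm
  · exact (hF a b h2).symm
  · simp [edgeFun]

lemma ev_FE_symm {N : Type*} [DecidableEq N] (Z : Finset N) (F : Finset (Sym2 N)) (p : PP N → ℚ)
    (a b : N) : MvPolynomial.eval p (FE Z F a b) = MvPolynomial.eval p (FE Z F b a) := by
  rw [ev_FE, ev_FE, Sym2.eq_swap]
  by_cases h : a = b
  · subst h; rfl
  · simp [h, Ne.symm h]

/-- Family for two statements with different pairs. -/
noncomputable def FC {N : Type*} [DecidableEq N] (Z : Finset N) (i j k l : N) (T : Finset N) :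
    Matrix N N (MvPolynomial (PP N) ℚ) :=
  Matrix.of fun a b =>
    if a = l ∧ b ∈ insert k T then
      ∑ m ∈ T, FE Z {s(i, j)} b m * MvPolynomial.X (Sum.inr (Sum.inl m))
    else if b = l ∧ a ∈ insert k T then
      ∑ m ∈ T, FE Z {s(i, j)} a m * MvPolynomial.X (Sum.inr (Sum.inl m))
    else FE Z {s(i, j)} a b

def VC {N : Type*} [Fintype N] [DecidableEq N] (Z : Finset N) (i j k l : N) (T : Finset N)
    (S : Matrix N N ℚ) : Prop :=
  S.IsSymm ∧ (∀ a, S a a = JJ Z a) ∧ S i j = 0 ∧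
    ∃ v : N → ℚ, (∀ m, m ∉ T → v m = 0) ∧ ∀ a ∈ insert k T, S a l = S.mulVec v a

lemma mulVec_restrict {N : Type*} [Fintype N] [DecidableEq N] (S : Matrix N N ℚ) (T : Finset N)
    (v : N → ℚ) (hv : ∀ m, m ∉ T → v m = 0) (a : N) :
    S.mulVec v a = ∑ m ∈ T, S a m * v m := by
  unfold Matrix.mulVec dotProduct
  symm
  apply Finset.sum_subset (Finset.subset_univ _)
  intro m _ hm
  rw [hv m hm, mul_zero]

lemma ev_FC {N : Type*} [DecidableEq N] (Z : Finset N) (i j k l : N) (T : Finset N)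
    (p : PP N → ℚ) (a b : N) : ev (FC Z i j k l T) p a b =
    if a = l ∧ b ∈ insert k T then
      ∑ m ∈ T, MvPolynomial.eval p (FE Z {s(i, j)} b m) * p (Sum.inr (Sum.inl m))
    else if b = l ∧ a ∈ insert k T then
      ∑ m ∈ T, MvPolynomial.eval p (FE Z {s(i, j)} a m) * p (Sum.inr (Sum.inl m))
    else MvPolynomial.eval p (FE Z {s(i, j)} a b) := by
  simp only [ev, Matrix.map_apply, FC, Matrix.of_apply]
  split_ifs <;> simp

lemma FC_VC {N : Type*} [Fintype N] [DecidableEq N] (Z : Finset N) (i j k l : N) (T : Finset N)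
    (hli : l ≠ i) (hlj : l ≠ j) (hij : i ≠ j) (hlk : l ≠ k) (hlT : l ∉ T) (p : PP N → ℚ) :
    VC Z i j k l T (ev (FC Z i j k l T) p) := by
  have hl : l ∉ insert k T := by simp [hlk, hlT]
  refine ⟨?_, ?_, ?_, ?_⟩
  · apply Matrix.IsSymm.ext
    intro a b
    rw [ev_FC, ev_FC]
    by_cases h1 : a = l ∧ b ∈ insert k T
    · have h2 : ¬ (b = l ∧ a ∈ insert k T) := by
        rintro ⟨h, _⟩; exact hl (h ▸ h1.2)
      rw [if_neg h2, if_pos h1, if_pos h1]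
    · by_cases h2 : b = l ∧ a ∈ insert k T
      · rw [if_pos h2, if_neg h1, if_pos h2]
      · rw [if_neg h2, if_neg h1, if_neg h1, if_neg h2, ev_FE_symm]
  · intro a
    have h2 : ¬ (a = l ∧ a ∈ insert k T) := by
      rintro ⟨h, h'⟩; exact hl (h ▸ h')
    rw [ev_FC, if_neg h2, if_neg h2, ev_FE, if_pos rfl]
  · rw [ev_FC, if_neg (fun h => hli h.1.symm), if_neg (fun h => hlj h.1.symm), ev_FE]
    simp [hij]
  · refine ⟨fun m => if m ∈ T then p (Sum.inr (Sum.inl m)) else 0, ?_, ?_⟩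
    · intro m hm; simp [hm]
    · intro a ha
      have hal : a ≠ l := fun h => hl (h ▸ ha)
      rw [mulVec_restrict _ T _ (fun m hm => by simp [hm]), ev_FC, if_neg (fun h => hal h.1),
        if_pos ⟨rfl, ha⟩]
      apply Finset.sum_congr rfl
      intro m hm
      have hml : m ≠ l := fun h => hlT (h ▸ hm)
      rw [ev_FC, if_neg (fun h => hal h.1), if_neg (fun h => hml h.1), if_pos hm]

lemma VC_FC {N : Type*} [Fintype N] [DecidableEq N] (Z : Finset N) (i j k l : N) (T : Finset N)
    (S : Matrix N N ℚ) (hS : VC Z i j k l T S) : ∃ p, ev (FC Z i j k l T) p = S := by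
  obtain ⟨h1, h2, h3, v, hv, h4⟩ := hS
  have h3' : ∀ a b, s(a, b) ∈ ({s(i, j)} : Finset (Sym2 N)) → S a b = 0 := by
    intro a b hab
    simp only [Finset.mem_singleton, Sym2.eq_iff] at hab
    rcases hab with ⟨rfl, rfl⟩ | ⟨rfl, rfl⟩
    · exact h3
    · rw [h1.apply]; exact h3
  refine ⟨Sum.elim (edgeFun S h1) (Sum.elim v 0), ?_⟩
  ext a b
  rw [ev_FC]
  simp only [ev_FE_edge Z _ S h1 h2 h3', Sum.elim_inr, Sum.elim_inl]
  split_ifs with c1 c2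
  · rw [← mulVec_restrict S T v hv, ← h4 b c1.2, c1.1, h1.apply]
  · rw [← mulVec_restrict S T v hv, ← h4 a c2.2, c2.1]
  · rfl

lemma FC_zero {N : Type*} [Fintype N] [DecidableEq N] (Z : Finset N) (i j k l : N) (T : Finset N)
    (hlk : l ≠ k) (hlT : l ∉ T) :
    ev (FC Z i j k l T) 0 = Matrix.diagonal (JJ Z) := by
  have hl : l ∉ insert k T := by simp [hlk, hlT]
  ext a b
  rw [ev_FC]
  by_cases hab : a = b
  · subst hab
    have h2 : ¬ (a = l ∧ a ∈ insert k T) := by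
      rintro ⟨h, h'⟩; exact hl (h ▸ h')
    rw [if_neg h2, if_neg h2, ev_FE]; simp
  · rw [Matrix.diagonal_apply_ne _ hab]
    split_ifs
    · simp
    · simp
    · rw [ev_FE]; simp [hab]

/-- Family for two statements with the same pair. -/
noncomputable def FD {N : Type*} [DecidableEq N] (Z : Finset N) (i j : N) (T : Finset N) :
    Matrix N N (MvPolynomial (PP N) ℚ) :=
  Matrix.of fun a b =>
    if a = j ∧ b ∈ T then
      ∑ m ∈ T, FE Z {s(i, j)} b m * MvPolynomial.X (Sum.inr (Sum.inl m))
    else if b = j ∧ a ∈ T then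
      ∑ m ∈ T, FE Z {s(i, j)} a m * MvPolynomial.X (Sum.inr (Sum.inl m))
    else if a = i ∧ b ∈ T then
      ∑ m ∈ T, (MvPolynomial.X (Sum.inr (Sum.inr (b, m))) - MvPolynomial.X (Sum.inr (Sum.inr (m, b))))
        * MvPolynomial.X (Sum.inr (Sum.inl m))
    else if b = i ∧ a ∈ T then
      ∑ m ∈ T, (MvPolynomial.X (Sum.inr (Sum.inr (a, m))) - MvPolynomial.X (Sum.inr (Sum.inr (m, a))))
        * MvPolynomial.X (Sum.inr (Sum.inl m))
    else FE Z {s(i, j)} a b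

def VD {N : Type*} [Fintype N] [DecidableEq N] (Z : Finset N) (i j : N) (T : Finset N)
    (S : Matrix N N ℚ) : Prop :=
  S.IsSymm ∧ (∀ a, S a a = JJ Z a) ∧ S i j = 0 ∧
    ∃ (v : N → ℚ) (A : Matrix N N ℚ), (∀ m, m ∉ T → v m = 0) ∧ (∀ a b, A a b = - A b a) ∧
      ∀ a ∈ T, S a j = S.mulVec v a ∧ S a i = A.mulVec v a

lemma ev_FD {N : Type*} [DecidableEq N] (Z : Finset N) (i j : N) (T : Finset N)
    (p : PP N → ℚ) (a b : N) : ev (FD Z i j T) p a b =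
    if a = j ∧ b ∈ T then
      ∑ m ∈ T, MvPolynomial.eval p (FE Z {s(i, j)} b m) * p (Sum.inr (Sum.inl m))
    else if b = j ∧ a ∈ T then
      ∑ m ∈ T, MvPolynomial.eval p (FE Z {s(i, j)} a m) * p (Sum.inr (Sum.inl m))
    else if a = i ∧ b ∈ T then
      ∑ m ∈ T, (p (Sum.inr (Sum.inr (b, m))) - p (Sum.inr (Sum.inr (m, b))))
        * p (Sum.inr (Sum.inl m))
    else if b = i ∧ a ∈ T then
      ∑ m ∈ T, (p (Sum.inr (Sum.inr (a, m))) - p (Sum.inr (Sum.inr (m, a))))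
        * p (Sum.inr (Sum.inl m))
    else MvPolynomial.eval p (FE Z {s(i, j)} a b) := by
  simp only [ev, Matrix.map_apply, FD, Matrix.of_apply]
  split_ifs <;> simp

lemma FD_VD {N : Type*} [Fintype N] [DecidableEq N] (Z : Finset N) (i j : N) (T : Finset N)
    (hij : i ≠ j) (hiT : i ∉ T) (hjT : j ∉ T) (p : PP N → ℚ) :
    VD Z i j T (ev (FD Z i j T) p) := by
  refine ⟨?_, ?_, ?_, ?_⟩
  · apply Matrix.IsSymm.ext
    intro a b
    rw [ev_FD, ev_FD, ev_FE_symm Z _ p b a]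
    by_cases h1 : a = j ∧ b ∈ T <;> by_cases h2 : b = j ∧ a ∈ T <;>
    by_cases h3 : a = i ∧ b ∈ T <;> by_cases h4 : b = i ∧ a ∈ T <;>
    simp only [h1, h2, h3, h4, if_false] <;> grind
  · intro a
    rw [ev_FD, if_neg, if_neg, if_neg, if_neg, ev_FE, if_pos rfl] <;> grind
  · rw [ev_FD, if_neg, if_neg, if_neg, if_neg, ev_FE]
    · simp [hij]
    all_goals grind
  · refine ⟨fun m => if m ∈ T then p (Sum.inr (Sum.inl m)) else 0,
      Matrix.of fun a b => p (Sum.inr (Sum.inr (a, b))) - p (Sum.inr (Sum.inr (b, a))), ?_, ?_, ?_⟩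
    · intro m hm; simp [hm]
    · intro a b; simp
    · intro a ha
      have hai : a ≠ i := fun h => hiT (h ▸ ha)
      have haj : a ≠ j := fun h => hjT (h ▸ ha)
      rw [mulVec_restrict _ T _ (fun m hm => by simp [hm]),
        mulVec_restrict _ T _ (fun m hm => by simp [hm])]
      constructor
      · rw [ev_FD, if_neg (fun h => haj h.1), if_pos ⟨rfl, ha⟩]
        apply Finset.sum_congr rfl
        intro m hm
        have hmi : m ≠ i := fun h => hiT (h ▸ hm)
        have hmj : m ≠ j := fun h => hjT (h ▸ hm)
        rw [ev_FD, if_neg (fun h => haj h.1), if_neg (fun h => hmj h.1),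
          if_neg (fun h => hai h.1), if_neg (fun h => hmi h.1), if_pos hm]
      · rw [ev_FD, if_neg (fun h => haj h.1), if_neg (fun h => hij h.1),
          if_neg (fun h => hai h.1), if_pos ⟨rfl, ha⟩]
        apply Finset.sum_congr rfl
        intro m hm
        simp [hm]

lemma VD_FD {N : Type*} [Fintype N] [DecidableEq N] (Z : Finset N) (i j : N) (T : Finset N)
    (S : Matrix N N ℚ) (hS : VD Z i j T S) : ∃ p, ev (FD Z i j T) p = S := by
  obtain ⟨h1, h2, h3, v, A, hv, hA, h4⟩ := hS
  have h3' : ∀ a b, s(a, b) ∈ ({s(i, j)} : Finset (Sym2 N)) → S a b = 0 := by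
    intro a b hab
    simp only [Finset.mem_singleton, Sym2.eq_iff] at hab
    rcases hab with ⟨rfl, rfl⟩ | ⟨rfl, rfl⟩
    · exact h3
    · rw [h1.apply]; exact h3
  have hA' : ∀ a b, A a b / 2 - A b a / 2 = A a b := by
    intro a b; rw [hA b a]; ring
  refine ⟨Sum.elim (edgeFun S h1) (Sum.elim v (fun q => A q.1 q.2 / 2)), ?_⟩
  ext a b
  rw [ev_FD]
  simp only [ev_FE_edge Z _ S h1 h2 h3', Sum.elim_inr, Sum.elim_inl, hA']
  split_ifs with c1 c2 c3 c4
  · rw [← mulVec_restrict S T v hv, ← (h4 b c1.2).1, c1.1, h1.apply]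
  · rw [← mulVec_restrict S T v hv, ← (h4 a c2.2).1, c2.1]
  · rw [← mulVec_restrict A T v hv, ← (h4 b c3.2).2, c3.1, h1.apply]
  · rw [← mulVec_restrict A T v hv, ← (h4 a c4.2).2, c4.1]
  · rfl

lemma FD_zero {N : Type*} [Fintype N] [DecidableEq N] (Z : Finset N) (i j : N) (T : Finset N)
    (hiT : i ∉ T) (hjT : j ∉ T) :
    ev (FD Z i j T) 0 = Matrix.diagonal (JJ Z) := by
  ext a b
  rw [ev_FD]
  by_cases hab : a = b
  · subst hab
    rw [if_neg, if_neg, if_neg, if_neg, ev_FE, if_pos rfl, Matrix.diagonal_apply_eq] <;> grind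
  · rw [Matrix.diagonal_apply_ne _ hab]
    split_ifs
    · simp
    · simp
    · simp
    · simp
    · rw [ev_FE]; simp [hab]


/-! ### Witness matrices -/

lemma JJ_sq {N : Type*} [DecidableEq N] (Z : Finset N) (a : N) : JJ Z a * JJ Z a = 1 := by
  unfold JJ; split_ifs <;> norm_num

def Ed {N : Type*} [DecidableEq N] (a b : N) (c : ℚ) : Matrix N N ℚ :=
  Matrix.of fun s t => if (s = a ∧ t = b) ∨ (s = b ∧ t = a) then c else 0

lemma Ed_apply {N : Type*} [DecidableEq N] (a b : N) (c : ℚ) (s t : N) :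
    Ed a b c s t = if (s = a ∧ t = b) ∨ (s = b ∧ t = a) then c else 0 := rfl

lemma Ed_symm {N : Type*} [DecidableEq N] (a b : N) (c : ℚ) : (Ed a b c).IsSymm := by
  apply Matrix.IsSymm.ext
  intro s t
  simp only [Ed_apply]
  congr 1
  apply propext
  tauto

lemma Ed_mulVec {N : Type*} [Fintype N] [DecidableEq N] (a b : N) (hab : a ≠ b) (c : ℚ)
    (x : N → ℚ) (t : N) : (Ed a b c).mulVec x t =
      (if t = a then c * x b else 0) + (if t = b then c * x a else 0) := by
  unfold Matrix.mulVec dotProduct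
  have : ∀ m, Ed a b c t m * x m = (if m = b then (if t = a then c * x m else 0) else 0) +
      (if m = a then (if t = b then c * x m else 0) else 0) := by
    intro m
    simp only [Ed_apply]
    grind
  simp only [this, Finset.sum_add_distrib, Finset.sum_ite_eq', Finset.mem_univ, if_true]

lemma D_symm {N : Type*} [DecidableEq N] (Z : Finset N) :
    (Matrix.diagonal (JJ Z)).IsSymm := Matrix.isSymm_diagonal _

/-- single edge -/
lemma C1 {N : Type*} [Fintype N] [DecidableEq N] (Z : Finset N) (i j k l p q : N) (T : Finset N)
    (hlk : l ≠ k) (hlT : l ∉ T) (hkT : k ∉ T)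
    (hpq : p ≠ q) (h1 : s(p, q) ≠ s(i, j)) (h2 : s(p, q) ≠ s(k, l)) (hij : i ≠ j) :
    VC Z i j k l T (Matrix.diagonal (JJ Z) + Ed p q 1) := by
  refine ⟨(D_symm Z).add (Ed_symm _ _ _), ?_, ?_,
    fun m => if (p = l ∧ m = q ∧ q ∈ T) ∨ (q = l ∧ m = p ∧ p ∈ T) then JJ Z m else 0, ?_, ?_⟩
  · intro a
    simp only [Matrix.add_apply, Matrix.diagonal_apply_eq, Ed_apply]
    grind
  · rw [Ne, Sym2.eq_iff] at h1
    simp only [Matrix.add_apply, Matrix.diagonal_apply_ne _ hij, Ed_apply]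
    grind
  · grind
  · rw [Ne, Sym2.eq_iff] at h2
    intro a ha
    have hal : a ≠ l := by grind
    have := JJ_sq Z a
    rw [Matrix.add_mulVec, Pi.add_apply, Matrix.mulVec_diagonal, Ed_mulVec _ _ hpq]
    simp only [Matrix.add_apply, Matrix.diagonal_apply_ne _ hal, Ed_apply]
    grind

lemma nS1 {N : Type*} [Fintype N] [DecidableEq N] (Z : Finset N) (p q : N) (L : Finset N)
    (hpq : p ≠ q) (hp : p ∉ L) (hq : q ∉ L) :
    ¬ Sing (Matrix.diagonal (JJ Z) + Ed p q 1) p q L := by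
  rintro ⟨x, hx, h0, hi, hL⟩
  apply hx
  simp only [Matrix.add_mulVec, Pi.add_apply, Matrix.mulVec_diagonal, Ed_mulVec _ _ hpq] at hi hL
  have hpx := h0 p hp hpq
  funext t
  have := JJ_sq Z t
  have := h0 t
  have := hL t
  simp only [Pi.zero_apply]
  grind

/-- two edges through m -/
lemma nS2 {N : Type*} [Fintype N] [DecidableEq N] (Z : Finset N) (p q m : N) (L : Finset N)
    (hpq : p ≠ q) (hp : p ∉ L) (hq : q ∉ L) (hm : m ∈ L) :
    ¬ Sing (Matrix.diagonal (JJ Z) + Ed p m 1 + Ed q m 1) p q L := by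
  have hpm : p ≠ m := by grind
  have hqm : q ≠ m := by grind
  rintro ⟨x, hx, h0, hi, hL⟩
  apply hx
  simp only [Matrix.add_mulVec, Pi.add_apply, Matrix.mulVec_diagonal, Ed_mulVec _ _ hpm,
    Ed_mulVec _ _ hqm] at hi hL
  have hpx := h0 p hp hpq
  have hxm : x m = 0 := by grind
  have := hL m hm
  have hxq : x q = 0 := by grind
  funext t
  have := JJ_sq Z t
  have := h0 t
  have := hL t
  simp only [Pi.zero_apply]
  grind


lemma C2a {N : Type*} [Fintype N] [DecidableEq N] (Z : Finset N) (i j k l m : N) (T : Finset N)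
    (hlk : l ≠ k) (hlT : l ∉ T) (hij : i ≠ j) (hli : l ≠ i) (hlj : l ≠ j)
    (hmi : m ≠ i) (hmj : m ≠ j) (hml : m ≠ l) :
    VC Z i j k l T (Matrix.diagonal (JJ Z) + Ed i m 1 + Ed j m 1) := by
  refine ⟨((D_symm Z).add (Ed_symm _ _ _)).add (Ed_symm _ _ _), ?_, ?_, 0, ?_, ?_⟩
  · intro a
    simp only [Matrix.add_apply, Matrix.diagonal_apply_eq, Ed_apply]
    grind
  · simp only [Matrix.add_apply, Matrix.diagonal_apply_ne _ hij, Ed_apply]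
    grind
  · intro _ _; rfl
  · intro a ha
    have hal : a ≠ l := by grind
    rw [Matrix.mulVec_zero]
    simp only [Matrix.add_apply, Matrix.diagonal_apply_ne _ hal, Ed_apply, Pi.zero_apply]
    grind

lemma C2b {N : Type*} [Fintype N] [DecidableEq N] (Z : Finset N) (i j k l : N) (T : Finset N)
    (hlk : l ≠ k) (hlT : l ∉ T) (hij : i ≠ j) (hli : l ≠ i) (hlj : l ≠ j)
    (hki : k ≠ i) (hkj : k ≠ j) :
    VC Z i j k l T (Matrix.diagonal (JJ Z) + Ed i l 1 + Ed j l 1) := by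
  refine ⟨((D_symm Z).add (Ed_symm _ _ _)).add (Ed_symm _ _ _), ?_, ?_,
    fun m => if (m = i ∨ m = j) ∧ m ∈ T then JJ Z m else 0, ?_, ?_⟩
  · intro a
    simp only [Matrix.add_apply, Matrix.diagonal_apply_eq, Ed_apply]
    grind
  · simp only [Matrix.add_apply, Matrix.diagonal_apply_ne _ hij, Ed_apply]
    grind
  · grind
  · intro a ha
    have hal : a ≠ l := by grind
    have := JJ_sq Z a
    simp only [Matrix.add_mulVec, Pi.add_apply, Matrix.mulVec_diagonal, Ed_mulVec _ _ hli.symm,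
      Ed_mulVec _ _ hlj.symm]
    simp only [Matrix.add_apply, Matrix.diagonal_apply_ne _ hal, Ed_apply]
    grind

lemma C2c {N : Type*} [Fintype N] [DecidableEq N] (Z : Finset N) (i j l m : N) (T : Finset N)
    (hlT : l ∉ T) (hiT : i ∉ T) (hij : i ≠ j) (hli : l ≠ i) (hlj : l ≠ j)
    (hm : m ∈ T) (hmj : m ≠ j) :
    ∃ S, VC Z i j i l T S ∧ ¬ Sing S i j {l} := by
  have hmi : m ≠ i := by grind
  have hml : m ≠ l := by grind
  refine ⟨Matrix.diagonal (JJ Z) + Ed i l (JJ Z m) + Ed i m 1 + Ed m l 1 + Ed j l 1, ?_, ?_⟩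
  · refine ⟨((((D_symm Z).add (Ed_symm _ _ _)).add (Ed_symm _ _ _)).add (Ed_symm _ _ _)).add
      (Ed_symm _ _ _), ?_, ?_,
      fun t => if t = m then JJ Z m else if t = j ∧ j ∈ T then JJ Z j else 0, ?_, ?_⟩
    · intro a
      simp only [Matrix.add_apply, Matrix.diagonal_apply_eq, Ed_apply]
      grind
    · simp only [Matrix.add_apply, Matrix.diagonal_apply_ne _ hij, Ed_apply]
      grind
    · grind
    · intro a ha
      have hal : a ≠ l := by grind
      have := JJ_sq Z a
      simp only [Matrix.add_mulVec, Pi.add_apply, Matrix.mulVec_diagonal, Ed_mulVec _ _ hli.symm,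
        Ed_mulVec _ _ hlj.symm, Ed_mulVec _ _ hmi.symm, Ed_mulVec _ _ hml]
      simp only [Matrix.add_apply, Matrix.diagonal_apply_ne _ hal, Ed_apply]
      grind
  · rintro ⟨x, hx, h0, hi, hL⟩
    apply hx
    simp only [Matrix.add_mulVec, Pi.add_apply, Matrix.mulVec_diagonal, Ed_mulVec _ _ hli.symm,
        Ed_mulVec _ _ hlj.symm, Ed_mulVec _ _ hmi.symm, Ed_mulVec _ _ hml] at hi hL
    have hL := hL l (by simp)
    have hJm := JJ_sq Z m
    have hxi := h0 i (by simp [hli.symm]) hij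
    have hxm := h0 m (by simp [hml]) hmj
    have hxl : x l = 0 := by grind
    have hxj : x j = 0 := by grind
    funext t
    have := h0 t
    simp only [Pi.zero_apply, Finset.mem_singleton] at *
    grind

lemma C3a {N : Type*} [Fintype N] [DecidableEq N] (Z : Finset N) (i j k l m : N) (T : Finset N)
    (hlk : l ≠ k) (hlT : l ∉ T) (hij : i ≠ j) (hli : l ≠ i) (hlj : l ≠ j) (hkj : k ≠ j)
    (hmk : m ≠ k) (hml : m ≠ l) (hmT : m ∉ T) (hk : k = i → m ≠ j) :
    VC Z i j k l T (Matrix.diagonal (JJ Z) + Ed k m 1 + Ed l m 1) := by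
  refine ⟨((D_symm Z).add (Ed_symm _ _ _)).add (Ed_symm _ _ _), ?_, ?_, 0, ?_, ?_⟩
  · intro a
    simp only [Matrix.add_apply, Matrix.diagonal_apply_eq, Ed_apply]
    grind
  · simp only [Matrix.add_apply, Matrix.diagonal_apply_ne _ hij, Ed_apply]
    grind
  · intro _ _; rfl
  · intro a ha
    have hal : a ≠ l := by grind
    rw [Matrix.mulVec_zero]
    simp only [Matrix.add_apply, Matrix.diagonal_apply_ne _ hal, Ed_apply, Pi.zero_apply]
    grind

lemma C3b {N : Type*} [Fintype N] [DecidableEq N] (Z : Finset N) (i j k l m : N) (T L : Finset N)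
    (hlk : l ≠ k) (hlT : l ∉ T) (hkT : k ∉ T) (hij : i ≠ j) (hli : l ≠ i) (hlj : l ≠ j)
    (hkj : k ≠ j) (hm : m ∈ T) (hk : k = i → m ≠ j) (hmL : m ∉ L) (hkL : k ∉ L) (hlL : l ∉ L) :
    ∃ S, VC Z i j k l T S ∧ ¬ Sing S k l L := by
  have hmk : m ≠ k := by grind
  have hml : m ≠ l := by grind
  refine ⟨Matrix.diagonal (JJ Z) + Ed k m 1 + Ed l m 1 + Ed k l (JJ Z m), ?_, ?_⟩
  · refine ⟨(((D_symm Z).add (Ed_symm _ _ _)).add (Ed_symm _ _ _)).add (Ed_symm _ _ _), ?_, ?_,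
      fun t => if t = m then JJ Z m else 0, ?_, ?_⟩
    · intro a
      simp only [Matrix.add_apply, Matrix.diagonal_apply_eq, Ed_apply]
      grind
    · simp only [Matrix.add_apply, Matrix.diagonal_apply_ne _ hij, Ed_apply]
      grind
    · grind
    · intro a ha
      have hal : a ≠ l := by grind
      have := JJ_sq Z a
      simp only [Matrix.add_mulVec, Pi.add_apply, Matrix.mulVec_diagonal, Ed_mulVec _ _ hmk.symm,
        Ed_mulVec _ _ hml.symm, Ed_mulVec _ _ hlk.symm]
      simp only [Matrix.add_apply, Matrix.diagonal_apply_ne _ hal, Ed_apply]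
      grind
  · rintro ⟨x, hx, h0, hi, hL⟩
    apply hx
    simp only [Matrix.add_mulVec, Pi.add_apply, Matrix.mulVec_diagonal, Ed_mulVec _ _ hmk.symm,
        Ed_mulVec _ _ hml.symm, Ed_mulVec _ _ hlk.symm] at hi hL
    have hJm := JJ_sq Z m
    have hxk := h0 k hkL hlk.symm
    have hxm := h0 m hmL hml
    have hxl : x l = 0 := by grind
    funext t
    have := JJ_sq Z t
    have := h0 t
    have := hL t
    simp only [Pi.zero_apply] at *
    grind

lemma C3c {N : Type*} [Fintype N] [DecidableEq N] (Z : Finset N) (i j l m : N) (T L : Finset N)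
    (hlT : l ∉ T) (hiT : i ∉ T) (hij : i ≠ j) (hli : l ≠ i) (hlj : l ≠ j)
    (hm : m ∈ T) (hmj : m ≠ j) (hmL : m ∈ L) (hjL : j ∈ L) (hjT : j ∉ T)
    (hiL : i ∉ L) (hlL : l ∉ L) :
    ∃ S, VC Z i j i l T S ∧ ¬ Sing S i l L := by
  have hmi : m ≠ i := by grind
  have hml : m ≠ l := by grind
  refine ⟨Matrix.diagonal (JJ Z) + Ed i m 1 + Ed m j 1 + Ed j l 1, ?_, ?_⟩
  · refine ⟨(((D_symm Z).add (Ed_symm _ _ _)).add (Ed_symm _ _ _)).add (Ed_symm _ _ _), ?_, ?_,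
      0, ?_, ?_⟩
    · intro a
      simp only [Matrix.add_apply, Matrix.diagonal_apply_eq, Ed_apply]
      grind
    · simp only [Matrix.add_apply, Matrix.diagonal_apply_ne _ hij, Ed_apply]
      grind
    · intro _ _; rfl
    · intro a ha
      have hal : a ≠ l := by grind
      rw [Matrix.mulVec_zero]
      simp only [Matrix.add_apply, Matrix.diagonal_apply_ne _ hal, Ed_apply, Pi.zero_apply]
      grind
  · rintro ⟨x, hx, h0, hi, hL⟩
    apply hx
    simp only [Matrix.add_mulVec, Pi.add_apply, Matrix.mulVec_diagonal, Ed_mulVec _ _ hmi.symm,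
        Ed_mulVec _ _ hmj, Ed_mulVec _ _ hlj.symm] at hi hL
    have hxi := h0 i hiL hli.symm
    have hLm := hL m hmL
    have hLj := hL j hjL
    have hxm : x m = 0 := by grind
    have hxj : x j = 0 := by grind
    have hxl : x l = 0 := by grind
    funext t
    have := JJ_sq Z t
    have := h0 t
    have := hL t
    simp only [Pi.zero_apply] at *
    grind

lemma C3d {N : Type*} [Fintype N] [DecidableEq N] (Z : Finset N) (i j l m : N) (T L : Finset N)
    (hlT : l ∉ T) (hiT : i ∉ T) (hij : i ≠ j) (hli : l ≠ i) (hlj : l ≠ j)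
    (hm : m ∈ T) (hmj : m ≠ j) (hmL : m ∈ L) (hjL : j ∉ L) (hjT : j ∈ T)
    (hiL : i ∉ L) (hlL : l ∉ L) :
    ∃ S, VC Z i j i l T S ∧ ¬ Sing S i l L := by
  have hmi : m ≠ i := by grind
  have hml : m ≠ l := by grind
  refine ⟨Matrix.diagonal (JJ Z) + Ed i m 1 + Ed m j 1 + Ed j l (JJ Z j - JJ Z m) +
    Ed i l (- JJ Z m), ?_, ?_⟩
  · refine ⟨((((D_symm Z).add (Ed_symm _ _ _)).add (Ed_symm _ _ _)).add (Ed_symm _ _ _)).add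
      (Ed_symm _ _ _), ?_, ?_,
      fun t => if t = m then - JJ Z m else if t = j then 1 else 0, ?_, ?_⟩
    · intro a
      simp only [Matrix.add_apply, Matrix.diagonal_apply_eq, Ed_apply]
      grind
    · simp only [Matrix.add_apply, Matrix.diagonal_apply_ne _ hij, Ed_apply]
      grind
    · grind
    · intro a ha
      have hal : a ≠ l := by grind
      have := JJ_sq Z m
      simp only [Matrix.add_mulVec, Pi.add_apply, Matrix.mulVec_diagonal, Ed_mulVec _ _ hmi.symm,
        Ed_mulVec _ _ hmj, Ed_mulVec _ _ hlj.symm, Ed_mulVec _ _ hli.symm]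
      simp only [Matrix.add_apply, Matrix.diagonal_apply_ne _ hal, Ed_apply]
      grind
  · rintro ⟨x, hx, h0, hi, hL⟩
    apply hx
    simp only [Matrix.add_mulVec, Pi.add_apply, Matrix.mulVec_diagonal, Ed_mulVec _ _ hmi.symm,
        Ed_mulVec _ _ hmj, Ed_mulVec _ _ hlj.symm, Ed_mulVec _ _ hli.symm] at hi hL
    have hxi := h0 i hiL hli.symm
    have hxj := h0 j hjL hlj.symm
    have hLm := hL m hmL
    have hJm := JJ_sq Z m
    have hxm : x m = 0 := by grind
    have hxl : x l = 0 := by grind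
    funext t
    have := JJ_sq Z t
    have := h0 t
    have := hL t
    simp only [Pi.zero_apply] at *
    grind

lemma wC {N : Type*} [Fintype N] [DecidableEq N] (Z : Finset N) (i j k l : N) (T : Finset N)
    (hlk : l ≠ k) (hlT : l ∉ T) (hkT : k ∉ T) (hij : i ≠ j) (hli : l ≠ i) (hlj : l ≠ j)
    (hkj : k ≠ j) (hT : k = i → ∃ m ∈ T, m ≠ j) (p q : N) (L : Finset N) (hpq : p ≠ q)
    (hp : p ∉ L) (hq : q ∉ L) (h1 : ¬ (s(p, q) = s(i, j) ∧ L = ∅))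
    (h2 : ¬ (s(p, q) = s(k, l) ∧ L = T)) : ∃ S, VC Z i j k l T S ∧ ¬ Sing S p q L := by
  by_cases e1 : s(p, q) = s(i, j)
  · have hL : L ≠ ∅ := fun h => h1 ⟨e1, h⟩
    have hiL : i ∉ L := by rw [Sym2.eq_iff] at e1; grind
    have hjL : j ∉ L := by rw [Sym2.eq_iff] at e1; grind
    have : ∃ S, VC Z i j k l T S ∧ ¬ Sing S i j L := by
      by_cases hex : ∃ m ∈ L, m ≠ l
      · obtain ⟨m, hm, hml⟩ := hex
        exact ⟨_, C2a Z i j k l m T hlk hlT hij hli hlj (by grind) (by grind) hml,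
          nS2 Z i j m L hij hiL hjL hm⟩
      · push Not at hex
        have hLl : L = {l} := by
          obtain ⟨m, hm⟩ := Finset.nonempty_iff_ne_empty.2 hL
          ext t
          rw [Finset.mem_singleton]
          exact ⟨hex t, fun h => by rw [h, ← hex m hm]; exact hm⟩
        by_cases hki : k = i
        · obtain ⟨m, hm, hmj⟩ := hT hki
          subst hki
          rw [hLl]
          exact C2c Z k j l m T hlT hkT hij hli hlj hm hmj
        · exact ⟨_, C2b Z i j k l T hlk hlT hij hli hlj hki hkj,
            nS2 Z i j l L hij hiL hjL (by simp [hLl])⟩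
    obtain ⟨S, hS, hn⟩ := this
    refine ⟨S, hS, ?_⟩
    rw [Sym2.eq_iff] at e1
    rcases e1 with ⟨rfl, rfl⟩ | ⟨rfl, rfl⟩
    · exact hn
    · rwa [Sing_comm S hS.1 _ _ _ hp hq]
  · by_cases e2 : s(p, q) = s(k, l)
    · have hLT : L ≠ T := fun h => h2 ⟨e2, h⟩
      have hkL : k ∉ L := by rw [Sym2.eq_iff] at e2; grind
      have hlL : l ∉ L := by rw [Sym2.eq_iff] at e2; grind
      have : ∃ S, VC Z i j k l T S ∧ ¬ Sing S k l L := by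
        by_cases hex : ∃ m ∈ L, m ∉ T ∧ (k = i → m ≠ j)
        · obtain ⟨m, hm, hmT, hk⟩ := hex
          exact ⟨_, C3a Z i j k l m T hlk hlT hij hli hlj hkj (by grind) (by grind) hmT hk,
            nS2 Z k l m L hlk.symm hkL hlL hm⟩
        · by_cases hex2 : ∃ m ∈ T, m ∉ L ∧ (k = i → m ≠ j)
          · obtain ⟨m, hm, hmL, hk⟩ := hex2
            exact C3b Z i j k l m T L hlk hlT hkT hij hli hlj hkj hm hk hmL hkL hlL
          · push Not at hex hex2
            have hki : k = i := by
              by_contra hki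
              apply hLT
              ext t
              constructor
              · intro h
                by_contra h'
                exact hki (hex t h h').1
              · intro h
                by_contra h'
                exact hki (hex2 t h h').1
            obtain ⟨m, hm, hmj⟩ := hT hki
            have hmL : m ∈ L := by
              by_contra h; exact hmj (hex2 m hm h).2
            subst hki
            by_cases hjT : j ∈ T
            · by_cases hjL : j ∈ L
              · exfalso
                apply hLT
                ext t
                have := hex t
                have := hex2 t
                grind
              · exact C3d Z k j l m T L hlT hkT hij hli hlj hm hmj hmL hjL hjT hkL hlL
            · by_cases hjL : j ∈ L
              · exact C3c Z k j l m T L hlT hkT hij hli hlj hm hmj hmL hjL hjT hkL hlL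
              · exfalso
                apply hLT
                ext t
                have := hex t
                have := hex2 t
                grind
      obtain ⟨S, hS, hn⟩ := this
      refine ⟨S, hS, ?_⟩
      rw [Sym2.eq_iff] at e2
      rcases e2 with ⟨rfl, rfl⟩ | ⟨rfl, rfl⟩
      · exact hn
      · rwa [Sing_comm S hS.1 _ _ _ hp hq]
    · exact ⟨_, C1 Z i j k l p q T hlk hlT hkT hpq e1 e2 hij, nS1 Z p q L hpq hp hq⟩


/-! ### Witnesses for two statements with the same pair -/

def Sk {N : Type*} [DecidableEq N] (a b : N) (c : ℚ) : Matrix N N ℚ :=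
  Matrix.of fun s t => if s = a ∧ t = b then c else if s = b ∧ t = a then - c else 0

lemma Sk_apply {N : Type*} [DecidableEq N] (a b : N) (c : ℚ) (s t : N) :
    Sk a b c s t = if s = a ∧ t = b then c else if s = b ∧ t = a then - c else 0 := rfl

lemma Sk_mulVec {N : Type*} [Fintype N] [DecidableEq N] (a b : N) (hab : a ≠ b) (c : ℚ)
    (x : N → ℚ) (t : N) : (Sk a b c).mulVec x t =
      (if t = a then c * x b else 0) + (if t = b then - c * x a else 0) := by
  unfold Matrix.mulVec dotProduct
  have : ∀ m, Sk a b c t m * x m = (if m = b then (if t = a then c * x m else 0) else 0) +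
      (if m = a then (if t = b then - c * x m else 0) else 0) := by
    intro m
    simp only [Sk_apply]
    grind
  simp only [this, Finset.sum_add_distrib, Finset.sum_ite_eq', Finset.mem_univ, if_true]

lemma D1 {N : Type*} [Fintype N] [DecidableEq N] (Z : Finset N) (i j p q : N) (T : Finset N)
    (hij : i ≠ j) (hiT : i ∉ T) (hjT : j ∉ T) (hpq : p ≠ q) (h1 : s(p, q) ≠ s(i, j))
    (h2 : ∀ m ∈ T, s(p, q) ≠ s(i, m)) :
    VD Z i j T (Matrix.diagonal (JJ Z) + Ed p q 1) := by
  refine ⟨(D_symm Z).add (Ed_symm _ _ _), ?_, ?_,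
    fun m => if (p = j ∧ m = q ∧ q ∈ T) ∨ (q = j ∧ m = p ∧ p ∈ T) then JJ Z m else 0, 0,
    ?_, ?_, ?_⟩
  · intro a
    simp only [Matrix.add_apply, Matrix.diagonal_apply_eq, Ed_apply]
    grind
  · rw [Ne, Sym2.eq_iff] at h1
    simp only [Matrix.add_apply, Matrix.diagonal_apply_ne _ hij, Ed_apply]
    grind
  · grind
  · simp
  · intro a ha
    have hai : a ≠ i := by grind
    have haj : a ≠ j := by grind
    have h2 := h2 a ha
    rw [Ne, Sym2.eq_iff] at h1 h2
    have := JJ_sq Z a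
    rw [Matrix.add_mulVec, Pi.add_apply, Matrix.mulVec_diagonal, Ed_mulVec _ _ hpq,
      Matrix.zero_mulVec]
    simp only [Matrix.add_apply, Matrix.diagonal_apply_ne _ hai, Matrix.diagonal_apply_ne _ haj,
      Ed_apply, Pi.zero_apply]
    grind

lemma D1b {N : Type*} [Fintype N] [DecidableEq N] (Z : Finset N) (i j m m' : N) (T L : Finset N)
    (hij : i ≠ j) (hiT : i ∉ T) (hjT : j ∉ T) (hm : m ∈ T) (hm' : m' ∈ T) (hmm : m' ≠ m)
    (hiL : i ∉ L) (hmL : m ∉ L) : ∃ S, VD Z i j T S ∧ ¬ Sing S i m L := by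
  have hmi : i ≠ m := by grind
  have hmj : j ≠ m' := by grind
  refine ⟨Matrix.diagonal (JJ Z) + Ed i m 1 + Ed j m' 2, ?_, ?_⟩
  · refine ⟨((D_symm Z).add (Ed_symm _ _ _)).add (Ed_symm _ _ _), ?_, ?_,
      fun t => if t = m' then 2 * JJ Z m' else 0, Sk m m' (JJ Z m' / 2), ?_, ?_, ?_⟩
    · intro a
      simp only [Matrix.add_apply, Matrix.diagonal_apply_eq, Ed_apply]
      grind
    · simp only [Matrix.add_apply, Matrix.diagonal_apply_ne _ hij, Ed_apply]
      grind
    · grind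
    · intro a b
      simp only [Sk_apply]
      grind
    · intro a ha
      have hai : a ≠ i := by grind
      have haj : a ≠ j := by grind
      have := JJ_sq Z m'
      simp only [Matrix.add_mulVec, Pi.add_apply, Matrix.mulVec_diagonal, Ed_mulVec _ _ hmi,
        Ed_mulVec _ _ hmj, Sk_mulVec _ _ hmm.symm]
      simp only [Matrix.add_apply, Matrix.diagonal_apply_ne _ hai,
        Matrix.diagonal_apply_ne _ haj, Ed_apply]
      grind
  · rintro ⟨x, hx, h0, hi, hL⟩
    apply hx
    simp only [Matrix.add_mulVec, Pi.add_apply, Matrix.mulVec_diagonal, Ed_mulVec _ _ hmi,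
      Ed_mulVec _ _ hmj] at hi hL
    have hxi := h0 i hiL hmi
    have hxm : x m = 0 := by grind
    have hmj2 : m' ≠ i := by grind
    have hJ : ∀ t, JJ Z t = 1 ∨ JJ Z t = -1 := by
      intro t; unfold JJ; split_ifs <;> simp
    have a1 := h0 j
    have a2 := hL j
    have a3 := h0 m'
    have a4 := hL m'
    have a5 := hJ j
    have a6 := hJ m'
    have hxj : x j = 0 := by
      by_cases c1 : j ∈ L <;> by_cases c2 : m' ∈ L <;> grind
    have hxm' : x m' = 0 := by
      by_cases c2 : m' ∈ L <;> grind
    funext t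
    have := JJ_sq Z t
    have := h0 t
    have := hL t
    simp only [Pi.zero_apply] at *
    grind

lemma D2a {N : Type*} [Fintype N] [DecidableEq N] (Z : Finset N) (i j m : N) (T : Finset N)
    (hij : i ≠ j) (hiT : i ∉ T) (hjT : j ∉ T) (hmi : m ≠ i) (hmj : m ≠ j) (hmT : m ∉ T) :
    VD Z i j T (Matrix.diagonal (JJ Z) + Ed i m 1 + Ed j m 1) := by
  refine ⟨((D_symm Z).add (Ed_symm _ _ _)).add (Ed_symm _ _ _), ?_, ?_, 0, 0, ?_, ?_, ?_⟩
  · intro a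
    simp only [Matrix.add_apply, Matrix.diagonal_apply_eq, Ed_apply]
    grind
  · simp only [Matrix.add_apply, Matrix.diagonal_apply_ne _ hij, Ed_apply]
    grind
  · intro _ _; rfl
  · simp
  · intro a ha
    have hai : a ≠ i := by grind
    have haj : a ≠ j := by grind
    rw [Matrix.mulVec_zero, Matrix.mulVec_zero]
    simp only [Matrix.add_apply, Matrix.diagonal_apply_ne _ hai, Matrix.diagonal_apply_ne _ haj,
      Ed_apply, Pi.zero_apply]
    grind

lemma D2b {N : Type*} [Fintype N] [DecidableEq N] (Z : Finset N) (i j m m' : N) (T L : Finset N)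
    (hij : i ≠ j) (hiT : i ∉ T) (hjT : j ∉ T) (hm : m ∈ T) (hm' : m' ∈ T)
    (hiL : i ∉ L) (hjL : j ∉ L) (hmL : m ∈ L) (hmL' : m' ∉ L) :
    ∃ S, VD Z i j T S ∧ ¬ Sing S i j L := by
  have hmm : m ≠ m' := by grind
  have e1 : i ≠ m := by grind
  have e2 : i ≠ m' := by grind
  have e3 : j ≠ m := by grind
  have e4 : j ≠ m' := by grind
  refine ⟨Matrix.diagonal (JJ Z) + Ed i m 1 + Ed i m' (-1) + Ed j m (JJ Z m) + Ed j m' (JJ Z m'),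
    ?_, ?_⟩
  · refine ⟨((((D_symm Z).add (Ed_symm _ _ _)).add (Ed_symm _ _ _)).add (Ed_symm _ _ _)).add
      (Ed_symm _ _ _), ?_, ?_,
      fun t => if t = m ∨ t = m' then 1 else 0, Sk m m' 1, ?_, ?_, ?_⟩
    · intro a
      simp only [Matrix.add_apply, Matrix.diagonal_apply_eq, Ed_apply]
      grind
    · simp only [Matrix.add_apply, Matrix.diagonal_apply_ne _ hij, Ed_apply]
      grind
    · grind
    · intro a b
      simp only [Sk_apply]
      grind
    · intro a ha
      have hai : a ≠ i := by grind
      have haj : a ≠ j := by grind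
      simp only [Matrix.add_mulVec, Pi.add_apply, Matrix.mulVec_diagonal, Ed_mulVec _ _ e1,
        Ed_mulVec _ _ e2, Ed_mulVec _ _ e3, Ed_mulVec _ _ e4, Sk_mulVec _ _ hmm]
      simp only [Matrix.add_apply, Matrix.diagonal_apply_ne _ hai,
        Matrix.diagonal_apply_ne _ haj, Ed_apply]
      grind
  · rintro ⟨x, hx, h0, hi, hL⟩
    apply hx
    simp only [Matrix.add_mulVec, Pi.add_apply, Matrix.mulVec_diagonal, Ed_mulVec _ _ e1,
        Ed_mulVec _ _ e2, Ed_mulVec _ _ e3, Ed_mulVec _ _ e4] at hi hL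
    have hxi := h0 i hiL hij
    have hxm' := h0 m' hmL' e4.symm
    have hLm := hL m hmL
    have hJm := JJ_sq Z m
    have hxm : x m = 0 := by grind
    have hxj : x j = 0 := by grind
    funext t
    have := JJ_sq Z t
    have := h0 t
    have := hL t
    simp only [Pi.zero_apply] at *
    grind

lemma wD {N : Type*} [Fintype N] [DecidableEq N] (Z : Finset N) (i j : N) (T : Finset N)
    (hij : i ≠ j) (hiT : i ∉ T) (hjT : j ∉ T) (hT : ∀ m ∈ T, ∃ m' ∈ T, m' ≠ m)
    (p q : N) (L : Finset N) (hpq : p ≠ q)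
    (hp : p ∉ L) (hq : q ∉ L) (h1 : ¬ (s(p, q) = s(i, j) ∧ L = ∅))
    (h2 : ¬ (s(p, q) = s(i, j) ∧ L = T)) : ∃ S, VD Z i j T S ∧ ¬ Sing S p q L := by
  by_cases e1 : s(p, q) = s(i, j)
  · have hL : L ≠ ∅ := fun h => h1 ⟨e1, h⟩
    have hLT : L ≠ T := fun h => h2 ⟨e1, h⟩
    have hiL : i ∉ L := by rw [Sym2.eq_iff] at e1; grind
    have hjL : j ∉ L := by rw [Sym2.eq_iff] at e1; grind
    have : ∃ S, VD Z i j T S ∧ ¬ Sing S i j L := by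
      by_cases hex : ∃ m ∈ L, m ∉ T
      · obtain ⟨m, hm, hmT⟩ := hex
        exact ⟨_, D2a Z i j m T hij hiT hjT (by grind) (by grind) hmT,
          nS2 Z i j m L hij hiL hjL hm⟩
      · push Not at hex
        obtain ⟨m, hm⟩ := Finset.nonempty_iff_ne_empty.2 hL
        have : ∃ m' ∈ T, m' ∉ L := by
          by_contra! hcon
          exact hLT (Finset.Subset.antisymm hex hcon)
        obtain ⟨m', hm', hmL'⟩ := this
        exact D2b Z i j m m' T L hij hiT hjT (hex m hm) hm' hiL hjL hm hmL'
    obtain ⟨S, hS, hn⟩ := this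
    refine ⟨S, hS, ?_⟩
    rw [Sym2.eq_iff] at e1
    rcases e1 with ⟨rfl, rfl⟩ | ⟨rfl, rfl⟩
    · exact hn
    · rwa [Sing_comm S hS.1 _ _ _ hp hq]
  · by_cases e2 : ∃ m ∈ T, s(p, q) = s(i, m)
    · obtain ⟨m, hm, e2⟩ := e2
      obtain ⟨m', hm', hmm⟩ := hT m hm
      have hiL : i ∉ L := by rw [Sym2.eq_iff] at e2; grind
      have hmL : m ∉ L := by rw [Sym2.eq_iff] at e2; grind
      obtain ⟨S, hS, hn⟩ := D1b Z i j m m' T L hij hiT hjT hm hm' hmm hiL hmL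
      refine ⟨S, hS, ?_⟩
      rw [Sym2.eq_iff] at e2
      rcases e2 with ⟨rfl, rfl⟩ | ⟨rfl, rfl⟩
      · exact hn
      · rwa [Sing_comm S hS.1 _ _ _ hp hq]
    · push Not at e2
      exact ⟨_, D1 Z i j p q T hij hiT hjT hpq e1 e2, nS1 Z p q L hpq hp hq⟩

/-! ### Singular statements -/

lemma Sing_empty {N : Type*} [Fintype N] [DecidableEq N] (S : Matrix N N ℚ) (i j : N)
    (h : S i j = 0) : Sing S i j ∅ := by
  refine ⟨Pi.single j 1, ?_, ?_, ?_, ?_⟩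
  · intro h0
    have := congrFun h0 j
    simp at this
  · intro m _ hm
    simp [hm]
  · simp [h]
  · simp

lemma VC_Sing {N : Type*} [Fintype N] [DecidableEq N] (Z : Finset N) (i j k l : N) (T : Finset N)
    (hlT : l ∉ T) (S : Matrix N N ℚ) (hS : VC Z i j k l T S) : Sing S k l T := by
  obtain ⟨h1, h2, h3, v, hv, h4⟩ := hS
  refine ⟨v - Pi.single l 1, ?_, ?_, ?_, ?_⟩
  · intro h0
    have := congrFun h0 l
    simp [hv l hlT] at this
  · intro m hm hml
    simp [hv m hm, hml]
  · simp [Matrix.mulVec_sub, ← h4 k (by simp)]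
  · intro m hm
    simp [Matrix.mulVec_sub, ← h4 m (by simp [hm])]

lemma VD_Sing {N : Type*} [Fintype N] [DecidableEq N] (Z : Finset N) (i j : N) (T : Finset N)
    (hjT : j ∉ T) (S : Matrix N N ℚ) (hS : VD Z i j T S) : Sing S i j T := by
  obtain ⟨h1, h2, h3, v, A, hv, hA, h4⟩ := hS
  refine ⟨v - Pi.single j 1, ?_, ?_, ?_, ?_⟩
  · intro h0
    have := congrFun h0 j
    simp [hv j hjT] at this
  · intro m hm hml
    simp [hv m hm, hml]
  · have : S.mulVec v i = 0 := by
      rw [mulVec_restrict S T v hv]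
      have e : ∀ m ∈ T, S i m * v m = ∑ m' ∈ T, A m m' * v m' * v m := by
        intro m hm
        rw [← h1.apply, (h4 m hm).2, mulVec_restrict A T v hv, Finset.sum_mul]
      rw [Finset.sum_congr rfl e]
      have e2 : ∑ m ∈ T, ∑ m' ∈ T, A m m' * v m' * v m
          = - ∑ m ∈ T, ∑ m' ∈ T, A m m' * v m' * v m := by
        conv_lhs => rw [Finset.sum_comm]
        rw [← Finset.sum_neg_distrib]
        apply Finset.sum_congr rfl
        intro m _
        rw [← Finset.sum_neg_distrib]
        apply Finset.sum_congr rfl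
        intro m' _
        rw [hA m' m]; ring
      linarith
    simp [Matrix.mulVec_sub, this, h3]
  · intro m hm
    simp [Matrix.mulVec_sub, ← (h4 m hm).1]

lemma Sing_four {N : Type*} [Fintype N] [DecidableEq N] (Z : Finset N) (S : Matrix N N ℚ)
    (i j k : N) (hjk : j ≠ k) (hd : S k k = JJ Z k) (h1 : S i j = 0) (h2 : S i k = 0) :
    Sing S i j {k} := by
  refine ⟨Pi.single j 1 - Pi.single k (S k j * JJ Z k), ?_, ?_, ?_, ?_⟩
  · intro h0
    have := congrFun h0 j
    simp [hjk] at this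
  · intro m hm hmj
    simp only [Finset.mem_singleton] at hm
    simp [hm, hmj]
  · simp [Matrix.mulVec_sub, h1, h2]
  · intro m hm
    simp only [Finset.mem_singleton] at hm
    subst hm
    have := JJ_sq Z m
    simp [Matrix.mulVec_sub, hd]
    linear_combination - (S m j) * this

/-! ### Final assembly -/

def Rlz {N : Type*} [Fintype N] [DecidableEq N] (G : Set (CIStmt N)) : Prop :=
    ∀ ε : ℝ, 0 < ε →
      ∃ Sig : Matrix N N ℚ, Sig.IsSymm ∧ PosDefMinors Sig ∧ CIS Sig = G ∧
        ∀ a b : N, |((Sig a b : ℝ)) - (1 : Matrix N N ℝ) a b| < ε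

lemma realE {N : Type*} [Fintype N] [DecidableEq N] (Z : Finset N) (F : Finset (Sym2 N))
    (hFd : ∀ a, s(a, a) ∉ F) (G : Set (CIStmt N)) (hGp : ∀ s ∈ G, s.proper)
    (h1 : ∀ p q L, p ≠ q → p ∉ L → q ∉ L → (s(p,q), L) ∈ G → ∀ S : Matrix N N ℚ, S.IsSymm →
      (∀ a, S a a = JJ Z a) → (∀ a b, s(a, b) ∈ F → S a b = 0) → Sing S p q (pset Z p q L))
    (h2 : ∀ p q L, p ≠ q → p ∉ L → q ∉ L → (s(p,q), L) ∉ G →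
      s(p, q) ∉ F ∨ ∃ m ∈ pset Z p q L, s(p, m) ∉ F ∧ s(q, m) ∉ F) : Rlz G := by
  have hs : ∀ p, (ev (FE Z F) p).IsSymm := by
    intro p
    apply Matrix.IsSymm.ext
    intro a b
    exact ev_FE_symm Z F p b a
  have back : ∀ S : Matrix N N ℚ, S.IsSymm → (∀ a, S a a = JJ Z a) →
      (∀ a b, s(a, b) ∈ F → S a b = 0) → ∃ p, ev (FE Z F) p = S := by
    intro S hS hd hF
    refine ⟨Sum.elim (edgeFun S hS) 0, ?_⟩
    ext a b
    exact ev_FE_edge Z F S hS hd hF 0 a b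
  refine realize Z (FE Z F) hs ?_ G hGp ?_ ?_
  · ext a b
    refine (ev_FE Z F 0 a b).trans ?_
    simp [Matrix.diagonal_apply]
  · intro p q L hpq hp hq hm x
    refine h1 p q L hpq hp hq hm _ (hs x) ?_ ?_
    · intro a
      refine (ev_FE Z F x a a).trans ?_
      simp
    · intro a b hab
      refine (ev_FE Z F x a b).trans ?_
      have : a ≠ b := by rintro rfl; exact hFd a hab
      simp [this, hab]
  · intro p q L hpq hp hq hm
    have hp' : p ∉ pset Z p q L := by simp [mem_pset]
    have hq' : q ∉ pset Z p q L := by simp [mem_pset]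
    rcases h2 p q L hpq hp hq hm with h | ⟨m, hm, ha, hb⟩
    · obtain ⟨x, hx⟩ := back (Matrix.diagonal (JJ Z) + Ed p q 1)
        ((D_symm Z).add (Ed_symm _ _ _))
        (by intro a
            simp only [Matrix.add_apply, Matrix.diagonal_apply_eq, Ed_apply]
            grind)
        (by intro a b hab
            have h3 : a ≠ b := by rintro rfl; exact hFd a hab
            have h4 : ¬ ((a = p ∧ b = q) ∨ (a = q ∧ b = p)) := by
              rw [← Sym2.eq_iff]; intro h5; rw [h5] at hab; exact h hab
            simp only [Matrix.add_apply, Matrix.diagonal_apply_ne _ h3, Ed_apply, if_neg h4,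
              add_zero])
      exact ⟨x, hx ▸ nS1 Z p q _ hpq hp' hq'⟩
    · have hmp : m ≠ p := by rintro rfl; exact hp' hm
      have hmq : m ≠ q := by rintro rfl; exact hq' hm
      obtain ⟨x, hx⟩ := back (Matrix.diagonal (JJ Z) + Ed p m 1 + Ed q m 1)
        (((D_symm Z).add (Ed_symm _ _ _)).add (Ed_symm _ _ _))
        (by intro a
            simp only [Matrix.add_apply, Matrix.diagonal_apply_eq, Ed_apply]
            grind)
        (by intro a b hab
            have h3 : a ≠ b := by rintro rfl; exact hFd a hab
            have h4 : ¬ ((a = p ∧ b = m) ∨ (a = m ∧ b = p)) := by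
              rw [← Sym2.eq_iff]; intro h5; rw [h5] at hab; exact ha hab
            have h5 : ¬ ((a = q ∧ b = m) ∨ (a = m ∧ b = q)) := by
              rw [← Sym2.eq_iff]; intro h5; rw [h5] at hab; exact hb hab
            simp only [Matrix.add_apply, Matrix.diagonal_apply_ne _ h3, Ed_apply, if_neg h4,
              if_neg h5, add_zero])
      exact ⟨x, hx ▸ nS2 Z p q m _ hpq hp' hq' hm⟩

lemma pset_self {N : Type*} [DecidableEq N] (Z : Finset N) (p q : N) : pset Z p q Z = ∅ := by
  ext m; simp only [mem_pset]; simp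

lemma pset_comm {N : Type*} [DecidableEq N] (Z : Finset N) (p q : N) (L : Finset N) :
    pset Z p q L = pset Z q p L := by
  ext m; simp only [mem_pset]; tauto

lemma pset_inj {N : Type*} [DecidableEq N] (Z : Finset N) (p q : N) (L L' : Finset N)
    (h1 : p ∉ L) (h2 : q ∉ L) (h3 : p ∉ L') (h4 : q ∉ L')
    (h : pset Z p q L = pset Z p q L') : L = L' := by
  ext m
  have := Finset.ext_iff.1 h m
  simp only [mem_pset] at this
  by_cases a : m = p
  · subst a; simp [h1, h3]
  by_cases b : m = q
  · subst b; simp [h2, h4]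
  tauto

/-- statements about a pair, seen through `pset` -/
lemma pset_eq_of {N : Type*} [DecidableEq N] (Z : Finset N) (p q i j : N) (L M : Finset N)
    (h1 : p ∉ L) (h2 : q ∉ L) (h3 : i ∉ M) (h4 : j ∉ M) (hs : s(p, q) = s(i, j))
    (h : pset Z p q L = pset Z i j M) : L = M := by
  rw [Sym2.eq_iff] at hs
  rcases hs with ⟨rfl, rfl⟩ | ⟨rfl, rfl⟩
  · exact pset_inj Z p q L M h1 h2 h3 h4 h
  · rw [pset_comm Z q p M] at h
    exact pset_inj Z p q L M h1 h2 h4 h3 h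

lemma rlz_empty {N : Type*} [Fintype N] [DecidableEq N] : Rlz (∅ : Set (CIStmt N)) := by
  refine realE ∅ ∅ (by simp) _ (by simp) (by simp) ?_
  intro p q L _ _ _ _
  left; simp

lemma rlz_one {N : Type*} [Fintype N] [DecidableEq N] (i j : N) (K : Finset N) (hij : i ≠ j)
    (hi : i ∉ K) (hj : j ∉ K) (hp : ∀ s ∈ ({(s(i, j), K)} : Set (CIStmt N)), s.proper) :
    Rlz ({(s(i, j), K)} : Set (CIStmt N)) := by
  refine realE K {s(i, j)} ?_ _ hp ?_ ?_
  · intro a h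
    rw [Finset.mem_singleton, Sym2.eq_iff] at h
    grind
  · intro p q L hpq hp hq hm S hS hd hF
    simp only [Set.mem_singleton_iff, Prod.mk.injEq] at hm
    obtain ⟨h1, rfl⟩ := hm
    rw [pset_self]
    exact Sing_empty _ _ _ (hF _ _ (by simp [h1]))
  · intro p q L hpq hp hq hm
    by_cases h : s(p, q) ∈ ({s(i, j)} : Finset (Sym2 N))
    · right
      rw [Finset.mem_singleton] at h
      have : (pset K p q L).Nonempty := by
        rw [Finset.nonempty_iff_ne_empty]
        intro h0
        apply hm
        rw [← pset_self K i j] at h0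
        rw [h, pset_eq_of K p q i j L K hp hq hi hj h h0]
        rfl
      obtain ⟨m, hm⟩ := this
      refine ⟨m, hm, ?_⟩
      rw [mem_pset] at hm
      rw [Finset.mem_singleton, Finset.mem_singleton, Sym2.eq_iff, Sym2.eq_iff]
      rw [Sym2.eq_iff] at h
      grind
    · left; exact h

def Four {N : Type*} [DecidableEq N] (i j k : N) (L : Finset N) : Set (CIStmt N) :=
  {(s(i, j), L), (s(i, k), L), (s(i, j), insert k L), (s(i, k), insert j L)}

lemma mem_Four {N : Type*} [DecidableEq N] (i j k : N) (L : Finset N) (hij : i ≠ j) (hik : i ≠ k)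
    (hjk : j ≠ k) (hi : i ∉ L) (hj : j ∉ L) (hk : k ∉ L) (p q : N) (M : Finset N) :
    (s(p, q), M) ∈ Four i j k L ↔
      ((p = i ∧ (q = j ∨ q = k)) ∨ (q = i ∧ (p = j ∨ p = k))) ∧ p ∉ M ∧ q ∉ M ∧
        ∀ t, t = j ∨ t = k ∨ (t ∈ M ↔ t ∈ L) := by
  simp only [Four, Set.mem_insert_iff, Set.mem_singleton_iff, Prod.mk.injEq, Sym2.eq_iff,
    Finset.ext_iff, Finset.mem_insert]
  constructor
  · rintro (⟨h, h'⟩ | ⟨h, h'⟩ | ⟨h, h'⟩ | ⟨h, h'⟩) <;> grind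
  · rintro ⟨h1, h2, h3, h4⟩
    by_cases hjM : j ∈ M
    · right; right; right
      grind
    · by_cases hkM : k ∈ M
      · right; right; left; grind
      · rcases h1 with ⟨rfl, rfl | rfl⟩ | ⟨rfl, rfl | rfl⟩ <;> grind

lemma Four_proper {N : Type*} [DecidableEq N] (i j k : N) (L : Finset N) (hij : i ≠ j) (hik : i ≠ k)
    (hjk : j ≠ k) (hi : i ∉ L) (hj : j ∉ L) (hk : k ∉ L) : ∀ s ∈ Four i j k L, s.proper := by
  intro s hs
  simp only [Four, Set.mem_insert_iff, Set.mem_singleton_iff] at hs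
  rcases hs with rfl | rfl | rfl | rfl <;>
    (simp only [CIStmt.proper, Sym2.mk_isDiag_iff, Sym2.mem_iff]; grind)

lemma Four_gaussoid {N : Type*} [DecidableEq N] (i j k : N) (L : Finset N) (hij : i ≠ j)
    (hik : i ≠ k) (hjk : j ≠ k) (hi : i ∉ L) (hj : j ∉ L) (hk : k ∉ L) :
    IsGaussoid (Four i j k L) := by
  refine ⟨Four_proper i j k L hij hik hjk hi hj hk, ?_⟩
  intro a b c M hab hac hbc ha hb hc
  simp only [mem_Four i j k L hij hik hjk hi hj hk, Finset.mem_insert]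
  refine ⟨⟨?_, ?_⟩, ⟨?_, ?_⟩, ?_⟩
  · rintro ⟨⟨h1, h2, h3, h4⟩, ⟨h5, h6, h7, h8⟩⟩
    grind
  · rintro ⟨⟨h1, h2, h3, h4⟩, ⟨h5, h6, h7, h8⟩⟩
    grind
  · rintro ⟨⟨h1, h2, h3, h4⟩, ⟨h5, h6, h7, h8⟩⟩
    grind
  · rintro ⟨⟨h1, h2, h3, h4⟩, ⟨h5, h6, h7, h8⟩⟩
    grind
  · rintro ⟨⟨h1, h2, h3, h4⟩, ⟨h5, h6, h7, h8⟩⟩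
    grind

lemma rlz_Four {N : Type*} [Fintype N] [DecidableEq N] (i j k : N) (L : Finset N) (hij : i ≠ j)
    (hik : i ≠ k) (hjk : j ≠ k) (hi : i ∉ L) (hj : j ∉ L) (hk : k ∉ L) :
    Rlz (Four i j k L) := by
  have hF : ∀ a b, s(a, b) ∈ ({s(i, j), s(i, k)} : Finset (Sym2 N)) ↔
      ((a = i ∧ (b = j ∨ b = k)) ∨ (b = i ∧ (a = j ∨ a = k))) := by
    intro a b
    simp only [Finset.mem_insert, Finset.mem_singleton, Sym2.eq_iff]
    tauto
  refine realE L {s(i, j), s(i, k)} ?_ _ (Four_proper i j k L hij hik hjk hi hj hk) ?_ ?_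
  · intro a h
    rw [hF] at h
    grind
  · intro p q M hpq hp hq hm S hS hd hF'
    have hij0 : S i j = 0 := hF' _ _ (by simp)
    have hik0 : S i k = 0 := hF' _ _ (by simp)
    have e1 : pset L i j (insert k L) = {k} := by
      ext m; simp only [mem_pset, Finset.mem_insert, Finset.mem_singleton]; grind
    have e2 : pset L i k (insert j L) = {j} := by
      ext m; simp only [mem_pset, Finset.mem_insert, Finset.mem_singleton]; grind
    have key : ∀ i' j' M, (s(p,q), M) = (s(i', j'), M) →
        Sing S i' j' (pset L i' j' M) → Sing S p q (pset L p q M) := by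
      intro i' j' M h h'
      rw [Prod.mk.injEq, Sym2.eq_iff] at h
      rcases h.1 with ⟨rfl, rfl⟩ | ⟨rfl, rfl⟩
      · exact h'
      · rw [pset_comm]
        refine (Sing_comm S hS q p _ ?_ ?_).1 h' <;> simp [mem_pset]
    simp only [Four, Set.mem_insert_iff, Set.mem_singleton_iff, Prod.mk.injEq] at hm
    rcases hm with ⟨h, rfl⟩ | ⟨h, rfl⟩ | ⟨h, rfl⟩ | ⟨h, rfl⟩
    · refine key i j _ (by rw [h]) ?_
      rw [pset_self]; exact Sing_empty _ _ _ hij0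
    · refine key i k _ (by rw [h]) ?_
      rw [pset_self]; exact Sing_empty _ _ _ hik0
    · refine key i j _ (by rw [h]) ?_
      rw [e1]; exact Sing_four L S i j k hjk (hd k) hij0 hik0
    · refine key i k _ (by rw [h]) ?_
      rw [e2]; exact Sing_four L S i k j hjk.symm (hd j) hik0 hij0
  · intro p q M hpq hp hq hm
    rw [mem_Four i j k L hij hik hjk hi hj hk] at hm
    by_cases h : s(p, q) ∈ ({s(i, j), s(i, k)} : Finset (Sym2 N))
    · right
      rw [hF] at h
      have : ∃ t, t ≠ j ∧ t ≠ k ∧ ¬ (t ∈ M ↔ t ∈ L) := by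
        by_contra hc
        push Not at hc
        refine hm ⟨h, hp, hq, fun t => ?_⟩
        have := hc t
        tauto
      obtain ⟨t, h1, h2, h3⟩ := this
      refine ⟨t, ?_, ?_⟩
      · rw [mem_pset]; grind
      · rw [hF, hF]; grind
    · left; exact h

lemma C_T {N : Type*} [Fintype N] [DecidableEq N] (i j l : N) (K M : Finset N)
    (hij : i ≠ j) (hli : l ≠ i) (hlj : l ≠ j)
    (hiK : i ∉ K) (hjK : j ∉ K) (hkM : i ∉ M) (hlM : l ∉ M)
    (hG : IsGaussoid ({(s(i, j), K), (s(i, l), M)} : Set (CIStmt N))) :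
    ∃ m ∈ pset K i l M, m ≠ j := by
  by_contra hc
  push Not at hc
  have hc' : ∀ m, m = i ∨ m = l ∨ m = j ∨ (m ∈ M ↔ m ∈ K) := by
    intro m
    have := hc m
    rw [mem_pset] at this
    tauto
  have m1 : ∀ X, (s(i, j), X) ∈ ({(s(i, j), K), (s(i, l), M)} : Set (CIStmt N)) ↔ X = K := by
    intro X
    simp only [Set.mem_insert_iff, Set.mem_singleton_iff, Prod.mk.injEq, Sym2.eq_iff]
    grind
  have m2 : ∀ X, (s(i, l), X) ∈ ({(s(i, j), K), (s(i, l), M)} : Set (CIStmt N)) ↔ X = M := by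
    intro X
    simp only [Set.mem_insert_iff, Set.mem_singleton_iff, Prod.mk.injEq, Sym2.eq_iff]
    grind
  have hL := hG.2 i j l (K.erase l) hij hli.symm hlj.symm (by simp [hiK]) (by simp [hjK]) (by simp)
  simp only [m1, m2] at hL
  obtain ⟨a1, a2, -⟩ := hL
  have b1 : ¬ (K.erase l = K ∧ insert l (K.erase l) = K) := by
    rintro ⟨h1, h2⟩
    have h3 : l ∈ K := by rw [← h2]; simp
    rw [Finset.erase_eq_self] at h1
    exact h1 h3
  have b3 : K.erase l = K ∨ insert l (K.erase l) = K := by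
    by_cases h : l ∈ K
    · right; exact Finset.insert_erase h
    · left; exact Finset.erase_eq_of_notMem h
  have b4 : K.erase l = M ∨ insert j (K.erase l) = M := by
    by_cases h : j ∈ M
    · right; ext m; rw [Finset.mem_insert, Finset.mem_erase]
      have := hc' m
      grind
    · left; ext m; rw [Finset.mem_erase]
      have := hc' m
      grind
  tauto

lemma rlz_C {N : Type*} [Fintype N] [DecidableEq N] (i j k l : N) (K M : Finset N)
    (hij : i ≠ j) (hlk : l ≠ k) (hli : l ≠ i) (hlj : l ≠ j) (hkj : k ≠ j)
    (hiK : i ∉ K) (hjK : j ∉ K) (hkM : k ∉ M) (hlM : l ∉ M)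
    (hG : IsGaussoid ({(s(i, j), K), (s(k, l), M)} : Set (CIStmt N))) :
    Rlz ({(s(i, j), K), (s(k, l), M)} : Set (CIStmt N)) := by
  set T := pset K k l M with hTdef
  have hkT : k ∉ T := by simp [hTdef, mem_pset]
  have hlT : l ∉ T := by simp [hTdef, mem_pset]
  have hT : k = i → ∃ m ∈ T, m ≠ j := by
    rintro rfl
    exact C_T k j l K M hij hli hlj hiK hjK hkM hlM hG
  have hV := FC_VC K i j k l T hli hlj hij hlk hlT
  refine realize K (FC K i j k l T) (fun p => (hV p).1) (FC_zero K i j k l T hlk hlT) _ hG.1 ?_ ?_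
  · intro p q L hpq hp hq hm x
    simp only [Set.mem_insert_iff, Set.mem_singleton_iff, Prod.mk.injEq] at hm
    rcases hm with ⟨h, rfl⟩ | ⟨h, rfl⟩
    · rw [pset_self]
      apply Sing_empty
      rw [Sym2.eq_iff] at h
      rcases h with ⟨rfl, rfl⟩ | ⟨rfl, rfl⟩
      · exact (hV x).2.2.1
      · rw [(hV x).1.apply]; exact (hV x).2.2.1
    · have hs := VC_Sing K i j k l T hlT _ (hV x)
      rw [Sym2.eq_iff] at h
      rcases h with ⟨rfl, rfl⟩ | ⟨rfl, rfl⟩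
      · exact hs
      · rw [pset_comm]
        exact (Sing_comm _ (hV x).1 q p _ hkT hlT).1 hs
  · intro p q L hpq hp hq hm
    obtain ⟨S, hS, hn⟩ := wC K i j k l T hlk hlT hkT hij hli hlj hkj hT p q (pset K p q L) hpq
      (by simp [mem_pset]) (by simp [mem_pset])
      (by
        rintro ⟨h, h0⟩
        rw [← pset_self K i j] at h0
        apply hm
        rw [h, pset_eq_of K p q i j L K hp hq hiK hjK h h0]
        simp)
      (by
        rintro ⟨h, h0⟩
        apply hm
        rw [h, pset_eq_of K p q k l L M hp hq hkM hlM h h0]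
        simp)
    obtain ⟨x, hx⟩ := VC_FC K i j k l T S hS
    exact ⟨x, hx ▸ hn⟩

lemma rlz_D {N : Type*} [Fintype N] [DecidableEq N] (i j : N) (K M : Finset N)
    (hij : i ≠ j) (hiK : i ∉ K) (hjK : j ∉ K) (hiM : i ∉ M) (hjM : j ∉ M)
    (hG : IsGaussoid ({(s(i, j), K), (s(i, j), M)} : Set (CIStmt N))) :
    Rlz ({(s(i, j), K), (s(i, j), M)} : Set (CIStmt N)) := by
  set T := pset K i j M with hTdef
  have hiT : i ∉ T := by simp [hTdef, mem_pset]
  have hjT : j ∉ T := by simp [hTdef, mem_pset]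
  have hT : ∀ m ∈ T, ∃ m' ∈ T, m' ≠ m := by
    intro m hm
    by_contra hc
    push Not at hc
    have hc' : ∀ t, t = i ∨ t = j ∨ t = m ∨ (t ∈ M ↔ t ∈ K) := by
      intro t
      have := hc t
      rw [hTdef, mem_pset] at this
      tauto
    rw [hTdef, mem_pset] at hm
    obtain ⟨hmi, hmj, hm⟩ := hm
    have hL := (hG.2 i j m (K.erase m) hij hmi.symm hmj.symm (by simp [hiK]) (by simp [hjK])
      (by simp)).2.2
    have e1 : (K.erase m = K ∧ insert m (K.erase m) = M) ∨
        (K.erase m = M ∧ insert m (K.erase m) = K) := by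
      rcases hm with ⟨h1, h2⟩ | ⟨h1, h2⟩
      · left
        refine ⟨Finset.erase_eq_of_notMem h2, ?_⟩
        rw [Finset.erase_eq_of_notMem h2]
        ext t; rw [Finset.mem_insert]
        have := hc' t
        grind
      · right
        refine ⟨?_, Finset.insert_erase h1⟩
        ext t; rw [Finset.mem_erase]
        have := hc' t
        grind
    have hL2 := hL (by
      rcases e1 with ⟨h1, h2⟩ | ⟨h1, h2⟩
      · rw [h2, h1]; simp
      · rw [h2, h1]; simp)
    simp only [Set.mem_insert_iff, Set.mem_singleton_iff, Prod.mk.injEq, Sym2.eq_iff] at hL2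
    grind
  have hV := FD_VD K i j T hij hiT hjT
  refine realize K (FD K i j T) (fun p => (hV p).1) (FD_zero K i j T hiT hjT) _ hG.1 ?_ ?_
  · intro p q L hpq hp hq hm x
    simp only [Set.mem_insert_iff, Set.mem_singleton_iff, Prod.mk.injEq] at hm
    rcases hm with ⟨h, rfl⟩ | ⟨h, rfl⟩
    · rw [pset_self]
      apply Sing_empty
      rw [Sym2.eq_iff] at h
      rcases h with ⟨rfl, rfl⟩ | ⟨rfl, rfl⟩
      · exact (hV x).2.2.1
      · rw [(hV x).1.apply]; exact (hV x).2.2.1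
    · have hs := VD_Sing K i j T hjT _ (hV x)
      rw [Sym2.eq_iff] at h
      rcases h with ⟨rfl, rfl⟩ | ⟨rfl, rfl⟩
      · exact hs
      · rw [pset_comm]
        exact (Sing_comm _ (hV x).1 q p _ hiT hjT).1 hs
  · intro p q L hpq hp hq hm
    obtain ⟨S, hS, hn⟩ := wD K i j T hij hiT hjT hT p q (pset K p q L) hpq
      (by simp [mem_pset]) (by simp [mem_pset])
      (by
        rintro ⟨h, h0⟩
        rw [← pset_self K i j] at h0
        apply hm
        rw [h, pset_eq_of K p q i j L K hp hq hiK hjK h h0]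
        simp)
      (by
        rintro ⟨h, h0⟩
        apply hm
        rw [h, pset_eq_of K p q i j L M hp hq hiM hjM h h0]
        simp)
    obtain ⟨x, hx⟩ := VD_FD K i j T S hS
    exact ⟨x, hx ▸ hn⟩

lemma proper_mk {N : Type*} (i j : N) (K : Finset N) :
    CIStmt.proper (s(i, j), K) ↔ i ≠ j ∧ i ∉ K ∧ j ∉ K := by
  simp [CIStmt.proper]

lemma rlz_two {N : Type*} [Fintype N] [DecidableEq N] (x y : CIStmt N)
    (hG : IsGaussoid ({x, y} : Set (CIStmt N))) : Rlz ({x, y} : Set (CIStmt N)) := by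
  obtain ⟨a, K⟩ := x
  obtain ⟨b, M⟩ := y
  induction a using Sym2.ind with | _ i j => ?_
  induction b using Sym2.ind with | _ k l => ?_
  have p1 := (proper_mk i j K).1 (hG.1 _ (by simp))
  have p2 := (proper_mk k l M).1 (hG.1 _ (by simp))
  obtain ⟨hij, hiK, hjK⟩ := p1
  obtain ⟨hkl, hkM, hlM⟩ := p2
  have main : ∀ i j k l : N, i ≠ j → i ∉ K → j ∉ K → k ≠ l → k ∉ M → l ∉ M →
      IsGaussoid ({(s(i, j), K), (s(k, l), M)} : Set (CIStmt N)) → l ≠ i → l ≠ j →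
      Rlz ({(s(i, j), K), (s(k, l), M)} : Set (CIStmt N)) := by
    intro i j k l hij hiK hjK hkl hkM hlM hG hli hlj
    by_cases hkj : k = j
    · rw [Sym2.eq_swap (a := i)] at hG ⊢
      exact rlz_C j i k l K M hij.symm hkl.symm hlj hli (by rw [hkj]; exact hij.symm)
        hjK hiK hkM hlM hG
    · exact rlz_C i j k l K M hij hkl.symm hli hlj hkj hiK hjK hkM hlM hG
  by_cases h : s(k, l) = s(i, j)
  · rw [h] at hG ⊢
    rw [Sym2.eq_iff] at h
    exact rlz_D i j K M hij hiK hjK (by grind) (by grind) hG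
  · rw [Sym2.eq_iff] at h
    by_cases hl : l ≠ i ∧ l ≠ j
    · exact main i j k l hij hiK hjK hkl hkM hlM hG hl.1 hl.2
    · rw [Sym2.eq_swap (a := k)] at hG ⊢
      exact main i j l k hij hiK hjK hkl.symm hlM hkM hG (by grind) (by grind)

lemma sub_two {α : Type*} (B : Set α) (hB : B.encard ≤ 2) (x y : α) (hx : x ∈ B) (hy : y ∈ B)
    (hxy : x ≠ y) : B = {x, y} := by
  symm
  have hfin : B.Finite := Set.finite_of_encard_le_coe (k := 2) hB
  apply hfin.eq_of_subset_of_encard_le'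
  · rintro z (rfl | rfl) <;> assumption
  · rw [Set.encard_pair hxy]; exact hB

lemma rlz_gauss {N : Type*} [Fintype N] [DecidableEq N] (B : Set (CIStmt N))
    (hB : B.encard ≤ 2) (hG : IsGaussoid B) : Rlz B := by
  by_cases h : ∃ x ∈ B, ∃ y ∈ B, x ≠ y
  · obtain ⟨x, hx, y, hy, hxy⟩ := h
    have := sub_two B hB x y hx hy hxy
    subst this
    exact rlz_two x y hG
  · push Not at h
    rcases B.eq_empty_or_nonempty with rfl | ⟨x, hx⟩
    · exact rlz_empty
    · have : B = {x} := by
        ext y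
        rw [Set.mem_singleton_iff]
        exact ⟨fun hy => (h x hx y hy).symm, fun e => e ▸ hx⟩
      subst this
      obtain ⟨a, K⟩ := x
      induction a using Sym2.ind with | _ i j => ?_
      have p1 := (proper_mk i j K).1 (hG.1 _ (by simp))
      exact rlz_one i j K p1.1 p1.2.1 p1.2.2 hG.1

lemma Four_sub {N : Type*} [DecidableEq N] (G : Set (CIStmt N)) (hG : IsGaussoid G) (i j k : N)
    (L : Finset N) (hij : i ≠ j) (hik : i ≠ k) (hjk : j ≠ k) (hi : i ∉ L) (hj : j ∉ L) (hk : k ∉ L)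
    (h : ((s(i,j), L) ∈ G ∧ (s(i,k), insert j L) ∈ G) ∨
        ((s(i,k), L) ∈ G ∧ (s(i,j), insert k L) ∈ G) ∨
      ((s(i,j), insert k L) ∈ G ∧ (s(i,k), insert j L) ∈ G) ∨
        ((s(i,j), L) ∈ G ∧ (s(i,k), L) ∈ G)) : Four i j k L ⊆ G := by
  have := hG.2 i j k L hij hik hjk hi hj hk
  have h4 : (s(i,j), L) ∈ G ∧ (s(i,k), L) ∈ G ∧ (s(i,j), insert k L) ∈ G ∧
      (s(i,k), insert j L) ∈ G := by tauto
  rintro z (rfl | rfl | rfl | rfl)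
  · exact h4.1
  · exact h4.2.1
  · exact h4.2.2.1
  · exact h4.2.2.2

lemma not_gauss {N : Type*} [DecidableEq N] (B : Set (CIStmt N)) (hBp : ∀ s ∈ B, s.proper)
    (hB : B.encard ≤ 2) (hn : ¬ IsGaussoid B) (G : Set (CIStmt N)) (hG : IsGaussoid G)
    (hBG : B ⊆ G) : ∃ (i j k : N) (L : Finset N), i ≠ j ∧ i ≠ k ∧ j ≠ k ∧ i ∉ L ∧ j ∉ L ∧ k ∉ L ∧
      B ⊆ Four i j k L ∧ Four i j k L ⊆ G := by
  by_contra hc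
  push Not at hc
  apply hn
  refine ⟨hBp, ?_⟩
  intro i j k L hij hik hjk hi hj hk
  have hF := Four_sub G hG i j k L hij hik hjk hi hj hk
  have hc1 := hc i j k L hij hik hjk hi hj hk
  have n1 : s(i, j) ≠ s(i, k) := by rw [Ne, Sym2.eq_iff]; grind
  have gen : ∀ x y, x ∈ B → y ∈ B → x ≠ y → ∀ i' j' k' : N, x ∈ Four i' j' k' L →
      y ∈ Four i' j' k' L → B ⊆ Four i' j' k' L := by
    intro x y hx hy hxy i' j' k' hx' hy'
    rw [sub_two B hB x y hx hy hxy]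
    rintro z (rfl | rfl) <;> assumption
  refine ⟨⟨?_, ?_⟩, ⟨?_, ?_⟩, ?_⟩
  · rintro ⟨a, b⟩
    exact absurd (hF (by have := hBG a; have := hBG b; tauto))
      (hc1 (gen _ _ a b (by simp [n1]) _ _ _ (by simp [Four]) (by simp [Four])))
  · rintro ⟨a, b⟩
    exact absurd (hF (by have := hBG a; have := hBG b; tauto))
      (hc1 (gen _ _ a b (by simp [n1.symm]) _ _ _ (by simp [Four]) (by simp [Four])))
  · rintro ⟨a, b⟩
    exact absurd (hF (by have := hBG a; have := hBG b; tauto))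
      (hc1 (gen _ _ a b (by simp [n1]) _ _ _ (by simp [Four]) (by simp [Four])))
  · rintro ⟨a, b⟩
    exact absurd (hF (by have := hBG a; have := hBG b; tauto))
      (hc1 (gen _ _ a b (by simp [n1]) _ _ _ (by simp [Four]) (by simp [Four])))
  · rintro ⟨a, b⟩
    exfalso
    have hne : ((s(i, j), L) : CIStmt N) ≠ (s(i, j), insert k L) := by
      intro h
      rw [Prod.mk.injEq] at h
      apply hk
      rw [h.2]; simp
    have a' := a
    have b' := b
    rcases (hG.2 i j k L hij hik hjk hi hj hk).2.2 ⟨hBG a, hBG b⟩ with h | h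
    · exact absurd (hF (by have := hBG a; tauto))
        (hc1 (gen _ _ a b hne _ _ _ (by simp [Four]) (by simp [Four])))
    · rw [Sym2.eq_swap] at a' b'
      refine absurd (Four_sub G hG j i k L hij.symm hjk hik hj hi hk (by have := hBG a'; tauto))
        (hc j i k L hij.symm hjk hik hj hi hk (gen _ _ a b hne _ _ _ ?_ ?_))
      · rw [Sym2.eq_swap]; simp [Four]
      · rw [Sym2.eq_swap]; simp [Four]

end GP

/-- Every minimal gaussoid extension of a set of at most two CI statements
is realizable by a rational positive-definite matrix arbitrarily close to the identity. -/
theorem stmt0 {N : Type*} [Fintype N] [DecidableEq N]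
    (B : Set (CIStmt N)) (hBproper : ∀ s ∈ B, s.proper) (hBcard : B.encard ≤ 2)
    (G : Set (CIStmt N)) (hG : IsGaussoid G) (hBG : B ⊆ G)
    (hmin : ∀ G' : Set (CIStmt N), IsGaussoid G' → B ⊆ G' → G' ⊆ G → G' = G) :
    ∀ ε : ℝ, 0 < ε →
      ∃ Sig : Matrix N N ℚ, Sig.IsSymm ∧ PosDefMinors Sig ∧ CIS Sig = G ∧
        ∀ a b : N, |((Sig a b : ℝ)) - (1 : Matrix N N ℝ) a b| < ε := by
  by_cases h : IsGaussoid B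
  · rw [← hmin B h subset_rfl hBG]
    exact GP.rlz_gauss B hBcard h
  · obtain ⟨i, j, k, L, hij, hik, hjk, hi, hj, hk, h1, h2⟩ :=
      GP.not_gauss B hBproper hBcard h G hG hBG
    rw [← hmin _ (GP.Four_gaussoid i j k L hij hik hjk hi hj hk) h1 h2]
    exact GP.rlz_Four i j k L hij hik hjk hi hj hk
end

section
/- Let N be a finite set, L ⊆ A_N with |L| ≤ 2, and M ⊆ A_N. Suppose that for every symmetric positive-definite real matrix Σ with rows and columns indexed by N satisfying L ⊆ CIS(Σ), one has CIS(Σ) ∩ M ≠ ∅. Then for every gaussoid G over N with L ⊆ G, one has G ∩ M ≠ ∅. (In other words: every CI inference rule with at most two antecedents that is valid for all regular real Gaussian CI structures is valid for all gaussoids.) -/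
open scoped symmDiff

variable {N : Type*} [DecidableEq N]

section helpers

/-- Weights whose squares are independent with respect to small integer coefficients. -/
lemma exists_weights (N : Type*) [Fintype N] :
    ∃ v : N → ℝ, (∀ n, 0 < v n) ∧ ∀ f : N → ℤ, (∀ n, |f n| ≤ 2) →
      ∑ n, (f n : ℝ) * (v n) ^ 2 = 0 → ∀ n, f n = 0 := by
  classical
  let idx := Fintype.equivFin N
  refine ⟨fun n => 3 ^ (idx n : ℕ), fun n => by positivity, ?_⟩
  intro f hf hs
  have hs' : ∑ n, f n * 9 ^ (idx n : ℕ) = 0 := by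
    have h : ((∑ n, f n * 9 ^ (idx n : ℕ) : ℤ) : ℝ) = 0 := by
      rw [← hs]
      push_cast
      refine Finset.sum_congr rfl fun n _ => ?_
      rw [← pow_mul, mul_comm (idx n : ℕ) 2, pow_mul]
      norm_num
    exact_mod_cast h
  by_contra! hne
  have hS : (Finset.univ.filter fun n => f n ≠ 0).Nonempty := by
    obtain ⟨n, hn⟩ := hne
    exact ⟨n, by simpa using hn⟩
  obtain ⟨n0, hn0, hmin⟩ := Finset.exists_min_image _ (fun n => (idx n : ℕ)) hS
  simp only [Finset.mem_filter, Finset.mem_univ, true_and] at hn0 hmin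
  rw [← Finset.add_sum_erase _ _ (Finset.mem_univ n0)] at hs'
  have hd : (9 : ℤ) ^ ((idx n0 : ℕ) + 1) ∣
      ∑ n ∈ Finset.univ.erase n0, f n * 9 ^ (idx n : ℕ) := by
    refine Finset.dvd_sum fun n hn => ?_
    have hn' := Finset.ne_of_mem_erase hn
    by_cases h0 : f n = 0
    · simp [h0]
    · have h1 := hmin n h0
      have h2 : (idx n : ℕ) ≠ idx n0 := fun h => hn' (idx.injective (Fin.ext h))
      exact Dvd.dvd.mul_left (pow_dvd_pow _ (by omega)) _
  have hd2 : (9 : ℤ) ^ ((idx n0 : ℕ) + 1) ∣ f n0 * 9 ^ (idx n0 : ℕ) := by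
    rw [eq_neg_of_add_eq_zero_left hs']
    exact (dvd_neg).2 hd
  rw [pow_succ, mul_comm (f n0)] at hd2
  have hd3 : (9 : ℤ) ∣ f n0 := Int.dvd_of_mul_dvd_mul_left (by positivity) hd2
  have := abs_le.1 (hf n0)
  omega

/-- The inverse function step. -/
lemma open_step {E : Type*} [NormedAddCommGroup E] [NormedSpace ℝ E] [CompleteSpace E]
    (F : ℝ × E → E) (q : E) (hF : ContDiff ℝ 1 F) (h0 : ∀ x, F (0, x) = x - q)
    (p : ℝ × E → Prop) (hp : ∀ᶠ z in nhds ((0 : ℝ), q), p z) :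
    ∃ t : ℝ, ∃ x : E, 0 < t ∧ F (t, x) = 0 ∧ p (t, x) := by
  let Φ : ℝ × E → ℝ × E := fun z => (z.1, F z)
  have hF' : HasStrictFDerivAt F (fderiv ℝ F (0, q)) (0, q) :=
    hF.contDiffAt.hasStrictFDerivAt (by norm_num)
  have hΦ : HasStrictFDerivAt Φ
      ((ContinuousLinearMap.fst ℝ ℝ E).prod (fderiv ℝ F (0, q))) (0, q) :=
    hasStrictFDerivAt_fst.prodMk hF'
  have hpart : ∀ x, fderiv ℝ F (0, q) (0, x) = x := by
    have h1 : HasFDerivAt (fun x : E => F (0, x))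
        ((fderiv ℝ F (0, q)).comp (ContinuousLinearMap.inr ℝ ℝ E)) q :=
      hF'.hasFDerivAt.comp q (hasFDerivAt_prodMk_right (0 : ℝ) q)
    have h2 : HasFDerivAt (fun x : E => F (0, x)) (ContinuousLinearMap.id ℝ E) q := by
      simp_rw [h0]
      exact (hasFDerivAt_id q).sub_const q
    intro x
    have := congrArg (fun l => l x) (h1.unique h2)
    simpa using this
  have hsurj : ((ContinuousLinearMap.fst ℝ ℝ E).prod (fderiv ℝ F (0, q))).range = ⊤ := by
    rw [LinearMap.range_eq_top]
    rintro ⟨s, y⟩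
    refine ⟨(s, y - fderiv ℝ F (0, q) (s, 0)), ?_⟩
    have : fderiv ℝ F (0, q) (s, y - fderiv ℝ F (0, q) (s, 0)) = y := by
      have e : ((s, y - fderiv ℝ F (0, q) (s, 0)) : ℝ × E)
          = (s, 0) + (0, y - fderiv ℝ F (0, q) (s, 0)) := by simp
      rw [e, map_add, hpart]
      abel
    simp [this]
  have hmap := hΦ.map_nhds_eq_of_surj hsurj
  have hΦ0 : Φ (0, q) = (0, 0) := by simp [Φ, h0]
  have hev : ∀ᶠ w in nhds ((0 : ℝ), (0 : E)), ∃ z, Φ z = w ∧ p z := by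
    rw [← hΦ0, ← hmap]
    exact Filter.eventually_map.2 (hp.mono fun z hz => ⟨z, rfl, hz⟩)
  have hc : Filter.Tendsto (fun t : ℝ => (t, (0 : E))) (nhds 0) (nhds (0, 0)) :=
    (Continuous.prodMk_left (0 : E)).tendsto' _ _ rfl
  obtain ⟨t, ⟨z, hz, hpz⟩, ht⟩ :=
    (((hc.eventually hev).filter_mono nhdsWithin_le_nhds).and
      (self_mem_nhdsWithin : Set.Ioi (0 : ℝ) ∈ nhdsWithin 0 (Set.Ioi 0))).exists
  obtain ⟨t', x⟩ := z
  simp only [Φ, Prod.mk.injEq] at hz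
  refine ⟨t', x, ?_, hz.2, hpz⟩
  rw [hz.1]
  exact ht

lemma apminor_def (M : Matrix N N ℝ) (i j : N) (K : Finset N) :
    apminor M i j K = (Matrix.of fun a b : Unit ⊕ K =>
      M (Sum.elim (fun _ => i) (fun k : K => (k : N)) a)
        (Sum.elim (fun _ => j) (fun k : K => (k : N)) b)).det := by
  unfold apminor
  congr 1
  ext a b
  rcases a with a | a <;> rcases b with b | b <;> rfl

/-- bordered determinant -/
noncomputable def Hg (t b : ℝ) (u v : N → ℝ) (B : Matrix N N ℝ) (K : Finset N) : ℝ :=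
  (Matrix.fromBlocks (Matrix.of fun _ _ : Unit => b) (Matrix.of fun (_ : Unit) (k : K) => u k)
    (Matrix.of fun (k : K) (_ : Unit) => v k)
    (Matrix.of fun k l : K => (1 : Matrix K K ℝ) k l + t * B k l)).det

lemma Hg_zero (b : ℝ) (u v : N → ℝ) (B : Matrix N N ℝ) (K : Finset N) :
    Hg 0 b u v B K = b - ∑ k ∈ K, u k * v k := by
  have : (Matrix.of fun k l : K => (1 : Matrix K K ℝ) k l + 0 * B k l) = 1 := by
    ext; simp
  rw [Hg, this, Matrix.det_fromBlocks_one₂₂]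
  simp [Matrix.mul_apply, Matrix.det_unique]
  exact Finset.sum_attach K (fun k => u k * v k)

lemma Hg_row (t b s : ℝ) (u v : N → ℝ) (B : Matrix N N ℝ) (K : Finset N) :
    Hg t (s * b) (fun n => s * u n) v B K = s * Hg t b u v B K := by
  unfold Hg
  rw [← Matrix.updateRow_eq_self (Matrix.fromBlocks (Matrix.of fun _ _ : Unit => b)
    (Matrix.of fun (_ : Unit) (k : K) => u k) (Matrix.of fun (k : K) (_ : Unit) => v k)
    (Matrix.of fun k l : K => (1 : Matrix K K ℝ) k l + t * B k l)) (Sum.inl ()),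
    ← Matrix.det_updateRow_smul]
  congr 1
  ext a c
  rcases a with a | a <;> rcases c with c | c <;> simp [Matrix.updateRow_apply]

lemma Hg_col (t b s : ℝ) (u v : N → ℝ) (B : Matrix N N ℝ) (K : Finset N) :
    Hg t (s * b) u (fun n => s * v n) B K = s * Hg t b u v B K := by
  unfold Hg
  rw [← Matrix.updateCol_eq_self (Matrix.fromBlocks (Matrix.of fun _ _ : Unit => b)
    (Matrix.of fun (_ : Unit) (k : K) => u k) (Matrix.of fun (k : K) (_ : Unit) => v k)
    (Matrix.of fun k l : K => (1 : Matrix K K ℝ) k l + t * B k l)) (Sum.inl ()),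
    ← Matrix.det_updateCol_smul]
  congr 1
  ext a c
  rcases a with a | a <;> rcases c with c | c <;> simp [Matrix.updateCol_apply]

lemma apminor_eq1 (t : ℝ) (B : Matrix N N ℝ) {i j : N} {K : Finset N} (hij : i ≠ j)
    (hi : i ∉ K) (hj : j ∉ K) :
    apminor (1 + t • B) i j K = t * Hg t (B i j) (B i) (fun n => t * B n j) B K := by
  rw [← Hg_row, apminor_def, Hg]
  congr 1
  ext a c
  rcases a with a | a <;> rcases c with c | c
  · change (1 + t • B) i j = t * B i j
    simp [hij]
  · have : i ≠ c := fun h => hi (h ▸ c.2)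
    change (1 + t • B) i c = t * B i c
    simp [this]
  · have : (a : N) ≠ j := fun h => hj (h ▸ a.2)
    change (1 + t • B) a j = t * B a j
    simp [this]
  · change (1 + t • B) a c = (1 : Matrix K K ℝ) a c + t * B a c
    simp [Matrix.one_apply, Subtype.val_inj]

lemma apminor_eq2 (t b : ℝ) (B : Matrix N N ℝ) {i j : N} {K : Finset N} (hij : i ≠ j)
    (hi : i ∉ K) (hj : j ∉ K) (hb : B i j = t * b) :
    apminor (1 + t • B) i j K = t * (t * Hg t b (B i) (fun n => B n j) B K) := by
  rw [apminor_eq1 t B hij hi hj, hb, Hg_col]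

lemma contDiff_Hg {E : Type*} [NormedAddCommGroup E] [NormedSpace ℝ E]
    {t b : E → ℝ} {u v : E → N → ℝ} {B : E → Matrix N N ℝ} (K : Finset N)
    (ht : ContDiff ℝ 1 t) (hb : ContDiff ℝ 1 b) (hu : ∀ n, ContDiff ℝ 1 fun z => u z n)
    (hv : ∀ n, ContDiff ℝ 1 fun z => v z n) (hB : ∀ m n, ContDiff ℝ 1 fun z => B z m n) :
    ContDiff ℝ 1 fun z => Hg (t z) (b z) (u z) (v z) (B z) K := by
  unfold Hg
  simp_rw [Matrix.det_apply']
  refine ContDiff.sum fun σ _ => contDiff_const.mul (contDiff_prod fun a _ => ?_)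
  rcases h : σ a with c | c <;> rcases a with a | a
  · simpa using hb
  · simpa using hu _
  · simpa using hv _
  · simpa using contDiff_const.add (ht.mul (hB _ _))

lemma contDiff_pminor {E : Type*} [NormedAddCommGroup E] [NormedSpace ℝ E]
    {B : E → Matrix N N ℝ} (K : Finset N) (hB : ∀ m n, ContDiff ℝ 1 fun z => B z m n) :
    ContDiff ℝ 1 fun z => pminor (B z) K := by
  unfold pminor
  simp_rw [Matrix.det_apply']
  refine ContDiff.sum fun σ _ => contDiff_const.mul (contDiff_prod fun a _ => ?_)
  simpa using hB _ _

lemma pminor_one (K : Finset N) : pminor (1 : Matrix N N ℝ) K = 1 := by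
  unfold pminor
  rw [Matrix.submatrix_one _ Subtype.val_injective, Matrix.det_one]

lemma apminor_symm {S : Matrix N N ℝ} (hS : S.IsSymm) (i j : N) (K : Finset N) :
    apminor S i j K = apminor S j i K := by
  rw [apminor_def, apminor_def, ← Matrix.det_transpose]
  congr 1
  ext a c
  rcases a with a | a <;> rcases c with c | c <;> simp [hS.apply]

lemma mem_CIS {S : Matrix N N ℝ} (hS : S.IsSymm) {i j : N} {K : Finset N} (hij : i ≠ j)
    (hi : i ∉ K) (hj : j ∉ K) : ((s(i, j), K) : CIStmt N) ∈ CIS S ↔ apminor S i j K = 0 := by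
  constructor
  · intro h
    exact h.2 i j rfl
  · intro h
    refine ⟨⟨by simpa using hij, ?_⟩, ?_⟩
    · intro k hk
      rcases Sym2.mem_iff.1 hk with rfl | rfl
      exacts [hi, hj]
    · intro a b hab
      rcases Sym2.eq_iff.1 hab with ⟨rfl, rfl⟩ | ⟨rfl, rfl⟩
      · exact h
      · rw [apminor_symm hS]; exact h

lemma ker_vec [Fintype N] {S : Matrix N N ℝ} {j : N} {K : Finset N} (hK : pminor S K ≠ 0)
    (hj : j ∉ K) : ∃ y : N → ℝ, y j = 1 ∧ (∀ n, n ≠ j → n ∉ K → y n = 0) ∧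
      ∀ k ∈ K, (S.mulVec y) k = 0 := by
  let A : Matrix K K ℝ := S.submatrix (fun a : K => (a : N)) (fun a : K => (a : N))
  have hA : IsUnit A.det := isUnit_iff_ne_zero.2 hK
  let x : K → ℝ := A⁻¹.mulVec (fun k => - S k j)
  have hx : A.mulVec x = fun k : K => - S k j := by
    simp [x, Matrix.mulVec_mulVec, Matrix.mul_nonsing_inv _ hA]
  refine ⟨fun n => if n = j then 1 else if h : n ∈ K then x ⟨n, h⟩ else 0, by simp, ?_, ?_⟩
  · intro n h1 h2; simp [h1, h2]
  · intro k hk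
    have h1 := congrFun hx ⟨k, hk⟩
    simp only [Matrix.mulVec, dotProduct] at h1 ⊢
    rw [← Finset.add_sum_erase _ _ (Finset.mem_univ j)]
    have h2 : ∑ n ∈ Finset.univ.erase j, S k n *
        (if n = j then 1 else if h : n ∈ K then x ⟨n, h⟩ else 0) =
        ∑ n ∈ K, S k n * (if h : n ∈ K then x ⟨n, h⟩ else 0) := by
      symm
      refine Finset.sum_subset_zero_on_sdiff ?_ ?_ ?_
      · intro n hn
        simp only [Finset.mem_erase, Finset.mem_univ, and_true]
        rintro rfl; exact hj hn
      · intro n hn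
        simp only [Finset.mem_sdiff, Finset.mem_erase, Finset.mem_univ, and_true] at hn
        simp [hn.1, hn.2]
      · intro n hn
        have : n ≠ j := by rintro rfl; exact hj hn
        simp [this]
    rw [h2, ← Finset.sum_coe_sort K]
    simp only [A, Matrix.submatrix_apply] at h1
    have h3 : ∀ n : K, S k n * (if h : (n : N) ∈ K then x ⟨n, h⟩ else 0) = S k n * x n := by
      intro n; simp
    rw [Finset.sum_congr rfl fun n _ => h3 n, h1]
    simp

/-- sum over a vector supported on `insert j K` -/
lemma mulVec_supp [Fintype N] {S : Matrix N N ℝ} {j : N} {K : Finset N} (hj : j ∉ K) {y : N → ℝ}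
    (hs : ∀ n, n ≠ j → n ∉ K → y n = 0) (a : N) :
    (S.mulVec y) a = S a j * y j + ∑ k : K, S a k * y k := by
  rw [Finset.sum_coe_sort K (fun k => S a k * y k), ← Finset.sum_insert (f := fun k => S a k * y k) hj]
  simp only [Matrix.mulVec, dotProduct]
  symm
  refine Finset.sum_subset (Finset.subset_univ _) ?_
  intro n _ hn
  simp only [Finset.mem_insert, not_or] at hn
  simp [hs n hn.1 hn.2]

lemma pminor_ker [Fintype N] {S : Matrix N N ℝ} {K : Finset N} (hK : pminor S K ≠ 0) {y : N → ℝ}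
    (hs : ∀ n, n ∉ K → y n = 0) (h0 : ∀ k ∈ K, (S.mulVec y) k = 0) : y = 0 := by
  have : (fun k : K => y k) = 0 := by
    by_contra hne
    refine hK (Matrix.exists_mulVec_eq_zero_iff.1 ⟨_, hne, ?_⟩)
    ext k
    have := h0 k k.2
    simp only [Matrix.mulVec, dotProduct] at this ⊢
    rw [← Finset.sum_subset (Finset.subset_univ K), ← Finset.sum_coe_sort K] at this
    · simpa using this
    · intro n _ hn; simp [hs n hn]
  ext n
  by_cases hn : n ∈ K
  · exact congrFun this ⟨n, hn⟩
  · simpa using hs n hn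

lemma apminor_iff [Fintype N] {S : Matrix N N ℝ} {i j : N} {K : Finset N} (hK : pminor S K ≠ 0)
    (hj : j ∉ K) {y : N → ℝ} (hy : y j = 1) (hs : ∀ n, n ≠ j → n ∉ K → y n = 0)
    (h0 : ∀ k ∈ K, (S.mulVec y) k = 0) : apminor S i j K = 0 ↔ (S.mulVec y) i = 0 := by
  rw [apminor_def, ← Matrix.exists_mulVec_eq_zero_iff]
  constructor
  · rintro ⟨w, hw, hw0⟩
    let z : N → ℝ := fun n => if n = j then w (Sum.inl ()) else
      if h : n ∈ K then w (Sum.inr ⟨n, h⟩) else 0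
    have hzj : z j = w (Sum.inl ()) := by simp [z]
    have hzK : ∀ k : K, z k = w (Sum.inr k) := by
      intro k
      have : (k : N) ≠ j := fun h => hj (h ▸ k.2)
      simp [z, this]
    have hzs : ∀ n, n ≠ j → n ∉ K → z n = 0 := by
      intro n h1 h2; simp [z, h1, h2]
    have hrow : ∀ a : Unit ⊕ K, (S.mulVec z) (Sum.elim (fun _ => i) (fun k : K => (k : N)) a) = 0 := by
      intro a
      have := congrFun hw0 a
      rw [mulVec_supp hj hzs, hzj]
      simp_rw [hzK]
      simpa [Matrix.mulVec, dotProduct] using this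
    have hz : z = w (Sum.inl ()) • y := by
      have : z - w (Sum.inl ()) • y = 0 := by
        refine pminor_ker hK ?_ ?_
        · intro n hn
          by_cases h : n = j
          · subst h; simp [hzj, hy]
          · simp [hzs n h hn, hs n h hn]
        · intro k hk
          have := hrow (Sum.inr ⟨k, hk⟩)
          simp only [Sum.elim_inr] at this
          simp [Matrix.mulVec_sub, Matrix.mulVec_smul, this, h0 k hk]
      exact sub_eq_zero.1 this
    have hi := hrow (Sum.inl ())
    simp only [Sum.elim_inl, hz, Matrix.mulVec_smul, Pi.smul_apply, smul_eq_mul, mul_eq_zero] at hi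
    rcases hi with hi | hi
    · exfalso
      apply hw
      have hz0 : z = 0 := by rw [hz, hi, zero_smul]
      ext a
      rcases a with a | a
      · exact hi
      · rw [← hzK, hz0]; rfl
    · exact hi
  · intro hi
    refine ⟨fun a => y (Sum.elim (fun _ => j) (fun k : K => (k : N)) a), ?_, ?_⟩
    · intro h
      have := congrFun h (Sum.inl ())
      simp [hy] at this
    · ext a
      have : (S.mulVec y) (Sum.elim (fun _ => i) (fun k : K => (k : N)) a) = 0 := by
        rcases a with a | a
        · exact hi
        · exact h0 a a.2
      rw [mulVec_supp hj hs] at this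
      simpa [Matrix.mulVec, dotProduct] using this

lemma face [Fintype N] {S : Matrix N N ℝ} (hP : PosDefMinors S) {a b m : N} {K : Finset N}
    (hbm : b ≠ m) (hb : b ∉ K) (hm : m ∉ K) (h0 : apminor S a b K = 0) :
    apminor S a b (insert m K) = 0 ↔ (apminor S a m K = 0 ∨ apminor S m b K = 0) := by
  have hK := (hP K).ne'
  have hKm := (hP (insert m K)).ne'
  obtain ⟨y, hy1, hys, hy0⟩ := ker_vec hK hb
  obtain ⟨z, hz1, hzs, hz0⟩ := ker_vec hK hm
  have hzm : (S.mulVec z) m ≠ 0 := by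
    intro h
    have : z = 0 := pminor_ker hKm (fun n hn => by
      simp only [Finset.mem_insert, not_or] at hn
      exact hzs n hn.1 hn.2) (fun k hk => by
      rcases Finset.mem_insert.1 hk with rfl | hk
      · exact h
      · exact hz0 k hk)
    simp [this] at hz1
  have hya := (apminor_iff (i := a) hK hb hy1 hys hy0).1 h0
  rw [apminor_iff hK hm hz1 hzs hz0, apminor_iff hK hb hy1 hys hy0]
  let c := - (S.mulVec y) m / (S.mulVec z) m
  rw [apminor_iff (y := y + c • z) hKm (by simp [hbm, hb])]
  · simp only [Matrix.mulVec_add, Matrix.mulVec_smul, Pi.add_apply, Pi.smul_apply, hya, zero_add,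
      smul_eq_mul, mul_eq_zero, c, div_eq_zero_iff, neg_eq_zero, hzm, or_false]
    tauto
  · simp [hy1, hzs b hbm hb]
  · intro n h1 h2
    simp only [Finset.mem_insert, not_or] at h2
    simp [hys n h1 h2.2, hzs n h2.1 h2.2]
  · intro k hk
    rcases Finset.mem_insert.1 hk with rfl | hk
    · simp only [Matrix.mulVec_add, Matrix.mulVec_smul, Pi.add_apply, Pi.smul_apply, smul_eq_mul, c]
      field_simp
      ring
    · simp [Matrix.mulVec_add, Matrix.mulVec_smul, hy0 k hk, hz0 k hk]

lemma sum_ind [Fintype N] (K : Finset N) (g : N → ℝ) :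
    ∑ k ∈ K, g k = ∑ n, (if n ∈ K then 1 else 0) * g n := by
  simp

lemma realize_A [Fintype N] (P : Finset (Sym2 N)) (κ : Sym2 N → Finset N)
    (hP : ∀ e ∈ P, CIStmt.proper (e, κ e)) :
    ∃ S : Matrix N N ℝ, S.IsSymm ∧ PosDefMinors S ∧ (∀ e ∈ P, (e, κ e) ∈ CIS S) ∧
      ∀ a b M', a ≠ b → a ∉ M' → b ∉ M' → apminor S a b M' = 0 →
        s(a, b) ∈ P ∧ ∀ n, n ≠ a → n ≠ b → s(a, n) ∉ P → s(b, n) ∉ P →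
          (n ∈ κ s(a, b) ↔ n ∈ M') := by
  obtain ⟨v, hv, hind⟩ := exists_weights N
  have hout : ∀ e : Sym2 N, ∃ i j, s(i, j) = e := fun e =>
    Sym2.ind (fun i j => ⟨i, j, rfl⟩) e
  choose I J hIJ using hout
  let B : ℝ × (Sym2 N → ℝ) → Matrix N N ℝ := fun z => Matrix.of fun a b =>
    if s(a, b) ∈ P then z.1 * z.2 s(a, b) else v a * v b
  let B0 : Matrix N N ℝ := Matrix.of fun a b => if s(a, b) ∈ P then 0 else v a * v b
  have hB0 : ∀ x, B (0, x) = B0 := by intro x; ext a b; simp [B, B0]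
  have hBs : ∀ z a b, B z a b = B z b a := by
    intro z a b
    simp only [B, Matrix.of_apply, Sym2.eq_swap (a := a) (b := b), mul_comm (v a)]
  have hB0s : ∀ a b, B0 a b = B0 b a := by
    intro a b
    rw [← hB0 0]; exact hBs _ _ _
  have hBc : ∀ a b, ContDiff ℝ 1 fun z => B z a b := by
    intro a b
    by_cases h : s(a, b) ∈ P
    · simp only [B, Matrix.of_apply, h, if_true]; fun_prop
    · simp only [B, Matrix.of_apply, h, if_false]; fun_prop
  let F : ℝ × (Sym2 N → ℝ) → (Sym2 N → ℝ) := fun z e =>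
    if e ∈ P then Hg z.1 (z.2 e) (B z (I e)) (fun n => B z n (J e)) (B z) (κ e) else z.2 e
  let q : Sym2 N → ℝ := fun e =>
    if e ∈ P then ∑ k ∈ κ e, B0 (I e) k * B0 k (J e) else 0
  have hq : ∀ a b, s(a, b) ∈ P → q s(a, b) = ∑ k ∈ κ s(a, b), B0 a k * B0 k b := by
    intro a b hab
    simp only [q, hab, if_true]
    rcases Sym2.eq_iff.1 (hIJ s(a, b)) with ⟨h1, h2⟩ | ⟨h1, h2⟩
    · rw [h1, h2]
    · rw [h1, h2]
      refine Finset.sum_congr rfl fun k _ => ?_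
      rw [hB0s b k, hB0s k a, mul_comm]
  have hFc : ContDiff ℝ 1 F := by
    rw [contDiff_pi]
    intro e
    by_cases h : e ∈ P
    · simp only [F, h, if_true]
      exact contDiff_Hg _ (by fun_prop) (by fun_prop) (fun n => hBc _ _) (fun n => hBc _ _) hBc
    · simp only [F, h, if_false]; fun_prop
  have hF0 : ∀ x, F (0, x) = x - q := by
    intro x
    ext e
    by_cases h : e ∈ P
    · simp [F, q, h, hB0, Hg_zero]
    · simp [F, q, h]
  let p : ℝ × (Sym2 N → ℝ) → Prop := fun z =>
    (∀ K, 0 < pminor (1 + z.1 • B z) K) ∧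
    (∀ a b M', s(a, b) ∉ P →
      Hg z.1 (B z a b) (B z a) (fun n => z.1 * B z n b) (B z) M' ≠ 0) ∧
    (∀ a b M', s(a, b) ∈ P → q s(a, b) - ∑ n ∈ M', B0 a n * B0 n b ≠ 0 →
      Hg z.1 (z.2 s(a, b)) (B z a) (fun n => B z n b) (B z) M' ≠ 0)
  have hp : ∀ᶠ z in nhds ((0 : ℝ), q), p z := by
    refine Filter.Eventually.and ?_ (Filter.Eventually.and ?_ ?_)
    · rw [Filter.eventually_all]
      intro K
      have hc : ContDiff ℝ 1 fun z => pminor (1 + z.1 • B z) K := by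
        refine contDiff_pminor K fun m n => ?_
        simp only [Matrix.add_apply, Matrix.smul_apply, smul_eq_mul]
        exact contDiff_const.add (contDiff_fst.mul (hBc m n))
      refine hc.continuous.continuousAt.eventually_const_lt ?_
      simp [pminor_one]
    · simp_rw [Filter.eventually_all]
      intro a b M' hab
      refine (contDiff_Hg M' contDiff_fst (hBc a b) (fun n => hBc a n)
        (fun n => contDiff_fst.mul (hBc n b)) hBc).continuous.continuousAt.eventually_ne ?_
      simp only [hB0, Hg_zero]
      simp [B0, hab, (hv _).ne']
    · simp_rw [Filter.eventually_all]
      intro a b M' hab hne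
      refine (contDiff_Hg M' contDiff_fst (b := fun z => z.2 s(a, b)) (by fun_prop)
        (fun n => hBc a n) (fun n => hBc n b) hBc).continuous.continuousAt.eventually_ne ?_
      simpa only [hB0, Hg_zero] using hne
  obtain ⟨t, x, ht, hF, hp1, hp2, hp3⟩ := open_step F q hFc hF0 p hp
  simp only at hp1 hp2 hp3
  have hS : (1 + t • B (t, x)).IsSymm := by
    ext a b
    simp [Matrix.one_apply, hBs _ b a, eq_comm]
  have hBP : ∀ a b, s(a, b) ∈ P → B (t, x) a b = t * x s(a, b) := by
    intro a b h; simp [B, h]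
  refine ⟨1 + t • B (t, x), hS, hp1, ?_, ?_⟩
  · intro e he
    have hpr := hP e he
    have hFe := congrFun hF e
    simp only [F, he, if_true, Pi.zero_apply] at hFe
    have he' := hIJ e
    have h1 : I e ≠ J e := by
      intro h
      apply hpr.1
      change e.IsDiag
      rw [← he', h]
      exact Sym2.mk_isDiag_iff.2 rfl
    have h2 : I e ∉ κ e := hpr.2 _ (by
      have h := Sym2.mem_mk_left (I e) (J e)
      rw [he'] at h
      exact h)
    have h3 : J e ∉ κ e := hpr.2 _ (by
      have h := Sym2.mem_mk_right (I e) (J e)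
      rw [he'] at h
      exact h)
    have := (mem_CIS hS h1 h2 h3).2 (by
      rw [apminor_eq2 t (x e) _ h1 h2 h3 (by rw [hBP _ _ (by rwa [he']), he']), hFe]
      simp)
    rwa [he'] at this
  · intro a b M' hab ha hb h0
    have hP' : s(a, b) ∈ P := by
      by_contra h
      rw [apminor_eq1 t _ hab ha hb] at h0
      rcases mul_eq_zero.1 h0 with h0 | h0
      · exact ht.ne' h0
      · exact hp2 a b M' h h0
    refine ⟨hP', ?_⟩
    rw [apminor_eq2 t (x s(a, b)) _ hab ha hb (hBP _ _ hP')] at h0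
    have hz : q s(a, b) - ∑ n ∈ M', B0 a n * B0 n b = 0 := by
      by_contra h
      have := hp3 a b M' hP' h
      exact (mul_ne_zero ht.ne' (mul_ne_zero ht.ne' this)) h0
    rw [hq a b hP'] at hz
    let f : N → ℤ := fun n => if s(a, n) ∈ P ∨ s(b, n) ∈ P then 0 else
      (if n ∈ κ s(a, b) then 1 else 0) - (if n ∈ M' then 1 else 0)
    have hf := hind f (by
      intro n
      simp only [f]
      split_ifs <;> simp) (by
      have : v a * v b * ∑ n, (f n : ℝ) * v n ^ 2 = 0 := by
        rw [← hz, sum_ind (κ s(a, b)), sum_ind M', ← Finset.sum_sub_distrib, Finset.mul_sum]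
        refine Finset.sum_congr rfl fun n _ => ?_
        simp only [f, B0, Matrix.of_apply, Sym2.eq_swap (a := n) (b := b)]
        by_cases h1 : s(a, n) ∈ P <;> by_cases h2 : s(b, n) ∈ P <;> simp [h1, h2]
        split_ifs <;> ring
      rcases mul_eq_zero.1 this with h | h
      · exact absurd h (mul_pos (hv a) (hv b)).ne'
      · exact h)
    intro n _ _ h1 h2
    have := hf n
    simp only [f, h1, h2, or_self, if_false] at this
    by_cases h3 : n ∈ κ s(a, b) <;> by_cases h4 : n ∈ M' <;> simp_all

lemma realize_B [Fintype N] {i j m0 m1 : N} {K M : Finset N} (hij : i ≠ j)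
    (hiK : i ∉ K) (hjK : j ∉ K) (hiM : i ∉ M) (hjM : j ∉ M) (hm0 : m0 ∈ K) (hm0' : m0 ∉ M)
    (hm1 : m1 ≠ m0) (hm1' : ¬ (m1 ∈ K ↔ m1 ∈ M)) :
    ∃ S : Matrix N N ℝ, S.IsSymm ∧ PosDefMinors S ∧ apminor S i j K = 0 ∧ apminor S i j M = 0 ∧
      ∀ a b M', a ≠ b → a ∉ M' → b ∉ M' → apminor S a b M' = 0 →
        s(a, b) = s(i, j) ∧ (M' = K ∨ M' = M) := by
  obtain ⟨v, hv, hind⟩ := exists_weights N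
  have hm0i : m0 ≠ i := by rintro rfl; exact hiK hm0
  have hm0j : m0 ≠ j := by rintro rfl; exact hjK hm0
  let B : ℝ × (ℝ × ℝ) → Matrix N N ℝ := fun z => Matrix.of fun a b =>
    if s(a, b) = s(i, j) then z.1 * z.2.1 else if s(a, b) = s(i, m0) then z.2.2 else v a * v b
  have hBs : ∀ z a b, B z a b = B z b a := by
    intro z a b
    simp only [B, Matrix.of_apply, Sym2.eq_swap (a := a) (b := b), mul_comm (v a)]
  have hBc : ∀ a b, ContDiff ℝ 1 fun z => B z a b := by
    intro a b
    simp only [B, Matrix.of_apply]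
    split_ifs <;> fun_prop
  let T : Finset N → ℝ := fun X => ∑ n, (((if n ≠ m0 ∧ n ∈ X then 1 else 0 : ℤ)) : ℝ) * v n ^ 2
  have hT : ∀ X Y, T X = T Y → ∀ n, n ≠ m0 → (n ∈ X ↔ n ∈ Y) := by
    intro X Y hXY n hn
    have := hind (fun n => (if n ≠ m0 ∧ n ∈ X then 1 else 0) - (if n ≠ m0 ∧ n ∈ Y then 1 else 0))
      (by intro n; split_ifs <;> simp) (by
        rw [← sub_eq_zero.2 hXY, ← Finset.sum_sub_distrib]
        refine Finset.sum_congr rfl fun n _ => ?_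
        push_cast
        ring) n
    by_cases h3 : n ∈ X <;> by_cases h4 : n ∈ Y <;> simp_all
  have hsum : ∀ (b c : ℝ) (X : Finset N), i ∉ X → j ∉ X →
      ∑ n ∈ X, B (0, (b, c)) i n * B (0, (b, c)) n j =
        (if m0 ∈ X then c * (v m0 * v j) else 0) + v i * v j * T X := by
    intro b c X hi hj
    have h1 : (if m0 ∈ X then c * (v m0 * v j) else 0) =
        ∑ n, if n = m0 then (if n ∈ X then c * (v m0 * v j) else 0) else 0 := by
      simp
    rw [h1, Finset.mul_sum, ← Finset.sum_add_distrib, sum_ind]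
    refine Finset.sum_congr rfl fun n _ => ?_
    by_cases hn : n ∈ X
    · have hni : n ≠ i := by rintro rfl; exact hi hn
      have hnj : n ≠ j := by rintro rfl; exact hj hn
      by_cases hnm : n = m0
      · subst hnm
        simp [B, hn, hni, hnj, hij, hij.symm]
      · simp [B, hn, hnm, hni, hnj, hij, hij.symm]
        ring
    · simp [hn]
  let c0 : ℝ := v i * (T M - T K) / v m0
  let b0 : ℝ := v i * v j * T M
  have hc0 : c0 ≠ 0 := by
    refine div_ne_zero (mul_ne_zero (hv i).ne' ?_) (hv m0).ne'
    intro h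
    exact hm1' (hT _ _ (sub_eq_zero.1 h) m1 hm1).symm
  have hc0' : c0 * (v m0 * v j) = v i * v j * (T M - T K) := by
    have := (hv m0).ne'
    simp only [c0]
    field_simp
  let HH : Finset N → ℝ × (ℝ × ℝ) → ℝ := fun X z =>
    Hg z.1 z.2.1 (B z i) (fun n => B z n j) (B z) X
  have hHc : ∀ X, ContDiff ℝ 1 (HH X) := fun X =>
    contDiff_Hg X contDiff_fst (by fun_prop) (fun n => hBc i n) (fun n => hBc n j) hBc
  have hw : v m0 * v j ≠ 0 := mul_ne_zero (hv _).ne' (hv _).ne'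
  let F : ℝ × (ℝ × ℝ) → ℝ × ℝ := fun z => (HH M z, (HH M z - HH K z) / (v m0 * v j))
  have hFc : ContDiff ℝ 1 F := (hHc M).prodMk (((hHc M).sub (hHc K)).div_const _)
  have hF0 : ∀ x, F (0, x) = x - (b0, c0) := by
    rintro ⟨b, c⟩
    simp only [F, HH, Hg_zero, hsum b c M hiM hjM, hsum b c K hiK hjK, hm0, hm0', if_true, if_false,
      Prod.mk_sub_mk, Prod.mk.injEq]
    refine ⟨by simp only [b0]; ring, ?_⟩
    rw [div_eq_iff hw, sub_mul, hc0']
    ring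
  let p : ℝ × (ℝ × ℝ) → Prop := fun z =>
    (∀ X, 0 < pminor (1 + z.1 • B z) X) ∧
    (∀ a b M', s(a, b) ≠ s(i, j) →
      Hg z.1 (B z a b) (B z a) (fun n => z.1 * B z n b) (B z) M' ≠ 0) ∧
    (∀ M', i ∉ M' → j ∉ M' → M' ≠ K → M' ≠ M → HH M' z ≠ 0)
  have hp : ∀ᶠ z in nhds ((0 : ℝ), (b0, c0)), p z := by
    refine Filter.Eventually.and ?_ (Filter.Eventually.and ?_ ?_)
    · rw [Filter.eventually_all]
      intro K
      have hc : ContDiff ℝ 1 fun z => pminor (1 + z.1 • B z) K := by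
        refine contDiff_pminor K fun m n => ?_
        simp only [Matrix.add_apply, Matrix.smul_apply, smul_eq_mul]
        exact contDiff_const.add (contDiff_fst.mul (hBc m n))
      refine hc.continuous.continuousAt.eventually_const_lt ?_
      simp [pminor_one]
    · simp_rw [Filter.eventually_all]
      intro a b M' hab
      refine (contDiff_Hg M' contDiff_fst (hBc a b) (fun n => hBc a n)
        (fun n => contDiff_fst.mul (hBc n b)) hBc).continuous.continuousAt.eventually_ne ?_
      simp only [Hg_zero, zero_mul, mul_zero, Finset.sum_const_zero, sub_zero]
      simp only [B, Matrix.of_apply, hab, if_false]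
      split_ifs
      · exact hc0
      · exact mul_ne_zero (hv _).ne' (hv _).ne'
    · simp_rw [Filter.eventually_all]
      intro M' hi hj hK hM
      refine (hHc M').continuous.continuousAt.eventually_ne ?_
      simp only [HH, Hg_zero, hsum b0 c0 M' hi hj]
      have hvv : v i * v j ≠ 0 := mul_ne_zero (hv _).ne' (hv _).ne'
      by_cases hm : m0 ∈ M'
      · simp only [hm, if_true, hc0', b0]
        intro h
        have h1 : v i * v j * (T K - T M') = 0 := by linarith
        have h2 := hT _ _ (sub_eq_zero.1 ((mul_eq_zero.1 h1).resolve_left hvv))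
        apply hK
        ext n
        by_cases hn : n = m0
        · subst hn; simp [hm, hm0]
        · exact (h2 n hn).symm
      · simp only [hm, if_false, b0]
        intro h
        have h1 : v i * v j * (T M - T M') = 0 := by linarith
        have h2 := hT _ _ (sub_eq_zero.1 ((mul_eq_zero.1 h1).resolve_left hvv))
        apply hM
        ext n
        by_cases hn : n = m0
        · subst hn; simp [hm, hm0']
        · exact (h2 n hn).symm
  obtain ⟨t, x, ht, hF, hp1, hp2, hp3⟩ := open_step F (b0, c0) hFc hF0 p hp
  simp only at hp1 hp2
  have hS : (1 + t • B (t, x)).IsSymm := by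
    ext a b
    simp [Matrix.one_apply, hBs _ b a, eq_comm]
  have hBij : B (t, x) i j = t * x.1 := by simp [B]
  have hM0 : HH M (t, x) = 0 := congrArg Prod.fst hF
  have hK0 : HH K (t, x) = 0 := by
    have h : (HH M (t, x) - HH K (t, x)) / (v m0 * v j) = 0 := congrArg Prod.snd hF
    rw [hM0, div_eq_zero_iff] at h
    simpa using h.resolve_right hw
  have hap : ∀ X, i ∉ X → j ∉ X →
      apminor (1 + t • B (t, x)) i j X = t * (t * HH X (t, x)) := fun X hi hj =>
    apminor_eq2 t x.1 _ hij hi hj hBij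
  refine ⟨1 + t • B (t, x), hS, hp1, ?_, ?_, ?_⟩
  · rw [hap K hiK hjK, hK0]; simp
  · rw [hap M hiM hjM, hM0]; simp
  · intro a b M' hab ha hb h0
    have hP' : s(a, b) = s(i, j) := by
      by_contra h
      rw [apminor_eq1 t _ hab ha hb] at h0
      rcases mul_eq_zero.1 h0 with h0 | h0
      · exact ht.ne' h0
      · exact hp2 a b M' h h0
    refine ⟨hP', ?_⟩
    have h1 : i ∉ M' ∧ j ∉ M' ∧ apminor (1 + t • B (t, x)) i j M' = 0 := by
      rcases Sym2.eq_iff.1 hP' with ⟨rfl, rfl⟩ | ⟨rfl, rfl⟩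
      · exact ⟨ha, hb, h0⟩
      · exact ⟨hb, ha, by rw [apminor_symm hS]; exact h0⟩
    by_contra! h
    refine hp3 M' h1.1 h1.2.1 h.1 h.2 ?_
    have := h1.2.2
    rw [hap M' h1.1 h1.2.1] at this
    simpa [ht.ne'] using this

lemma finish_A [Fintype N] (P : Finset (Sym2 N)) (κ : Sym2 N → Finset N)
    (hP : ∀ e ∈ P, CIStmt.proper (e, κ e)) (hcard : P.card ≤ 2) {G : Set (CIStmt N)}
    (hG : IsGaussoid G) (hPG : ∀ e ∈ P, (e, κ e) ∈ G) :
    ∃ S : Matrix N N ℝ, S.IsSymm ∧ PosDefMinors S ∧ (∀ e ∈ P, (e, κ e) ∈ CIS S) ∧ CIS S ⊆ G := by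
  obtain ⟨S, hS, hpd, hmem, h⟩ := realize_A P κ hP
  refine ⟨S, hS, hpd, hmem, ?_⟩
  have hnot : ∀ a b, s(a, b) ∈ P → a ∉ κ s(a, b) ∧ b ∉ κ s(a, b) := fun a b hab =>
    ⟨(hP _ hab).2 a (by simp), (hP _ hab).2 b (by simp)⟩
  have core : ∀ a b m M', a ≠ b → a ∉ M' → b ∉ M' → apminor S a b M' = 0 → m ≠ a → m ≠ b →
      s(a, b) ∈ P → s(a, m) ∈ P → ¬ (m ∈ κ s(a, b) ↔ m ∈ M') →
      ((s(a, b), M') : CIStmt N) ∈ G := by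
    intro a b m M' hab ha hb h0 hma hmb hPab hPam hm
    have hPeq : ∀ e ∈ P, e = s(a, b) ∨ e = s(a, m) := by
      intro e he
      by_contra! hne
      have hsub : ({e, s(a, b), s(a, m)} : Finset (Sym2 N)) ⊆ P := by
        intro f hf
        simp only [Finset.mem_insert, Finset.mem_singleton] at hf
        rcases hf with rfl | rfl | rfl <;> assumption
      have h3 : s(a, b) ≠ s(a, m) := by
        intro h'
        exact hmb (Sym2.congr_right.1 h').symm
      have := Finset.card_le_card hsub
      rw [Finset.card_eq_three.2 ⟨_, _, _, hne.1, hne.2, h3, rfl⟩] at this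
      omega
    have han : ∀ n, s(a, n) ∈ P → n = b ∨ n = m := by
      intro n hn
      rcases hPeq _ hn with h' | h'
      · exact Or.inl (Sym2.congr_right.1 h')
      · exact Or.inr (Sym2.congr_right.1 h')
    have hbn : ∀ n, s(b, n) ∈ P → n = a := by
      intro n hn
      rcases hPeq _ hn with h' | h' <;> rcases Sym2.eq_iff.1 h' with ⟨h1, h2⟩ | ⟨h1, h2⟩
      · exact absurd h1.symm hab
      · exact h2
      · exact absurd h1.symm hab
      · exact h2
    have hmn : ∀ n, s(m, n) ∈ P → n = a := by
      intro n hn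
      rcases hPeq _ hn with h' | h' <;> rcases Sym2.eq_iff.1 h' with ⟨h1, h2⟩ | ⟨h1, h2⟩
      · exact absurd h1 hma
      · exact h2
      · exact absurd h1 hma
      · exact h2
    obtain ⟨hna, hnb⟩ := hnot a b hPab
    obtain ⟨hna', hnm'⟩ := hnot a m hPam
    have hagree : ∀ n, n ≠ m → (n ∈ κ s(a, b) ↔ n ∈ M') := by
      intro n hn
      by_cases h1 : n = a
      · subst h1; simp [hna, ha]
      by_cases h2 : n = b
      · subst h2; simp [hnb, hb]
      refine (h a b M' hab ha hb h0).2 n h1 h2 ?_ ?_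
      · intro h'
        rcases han n h' with h' | h'
        exacts [h2 h', hn h']
      · intro h'
        exact h1 (hbn n h')
    set K := (κ s(a, b)).erase m with hK
    have haK : a ∉ K := fun h' => hna (Finset.mem_of_mem_erase h')
    have hbK : b ∉ K := fun h' => hnb (Finset.mem_of_mem_erase h')
    have hmK : m ∉ K := Finset.notMem_erase _ _
    have hap := h0
    have hap' := (mem_CIS hS hab hna hnb).1 (hmem _ hPab)
    have hKM : (κ s(a, b) = K ∧ M' = insert m K) ∨ (κ s(a, b) = insert m K ∧ M' = K) := by
      by_cases hmκ : m ∈ κ s(a, b)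
      · right
        refine ⟨(Finset.insert_erase hmκ).symm, ?_⟩
        ext n
        by_cases hn : n = m
        · subst hn; simp [hmK]; tauto
        · rw [← hagree n hn]; simp [hK, hn]
      · left
        refine ⟨(Finset.erase_eq_of_notMem hmκ).symm, ?_⟩
        ext n
        by_cases hn : n = m
        · subst hn; simp; tauto
        · rw [← hagree n hn]; simp [hK, hn]
    have hboth : apminor S a b K = 0 ∧ apminor S a b (insert m K) = 0 := by
      rcases hKM with ⟨h1, h2⟩ | ⟨h1, h2⟩
      · rw [h2] at hap; rw [h1] at hap'; exact ⟨hap', hap⟩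
      · rw [h2] at hap; rw [h1] at hap'; exact ⟨hap, hap'⟩
    have hamK : apminor S a m K = 0 := by
      rcases (face hpd hmb.symm hbK hmK hboth.1).1 hboth.2 with h' | h'
      · exact h'
      · exact absurd (hmn b (h m b K hmb hmK hbK h').1) hab.symm
    have hagree2 : ∀ n, n ≠ b → (n ∈ κ s(a, m) ↔ n ∈ K) := by
      intro n hn
      by_cases h1 : n = a
      · subst h1; simp [hna', haK]
      by_cases h2 : n = m
      · subst h2; simp [hnm', hmK]
      refine (h a m K hma.symm haK hmK hamK).2 n h1 h2 ?_ ?_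
      · intro h'
        rcases han n h' with h' | h'
        exacts [hn h', h2 h']
      · intro h'
        exact h1 (hmn n h')
    have hK2 : κ s(a, m) = K ∨ κ s(a, m) = insert b K := by
      by_cases hbκ : b ∈ κ s(a, m)
      · right
        ext n
        by_cases hn : n = b
        · subst hn; simp [hbκ]
        · rw [hagree2 n hn]; simp [hn]
      · left
        ext n
        by_cases hn : n = b
        · subst hn; simp [hbκ, hbK]
        · exact hagree2 n hn
    have g1 := hPG _ hPab
    have g2 := hPG _ hPam
    obtain ⟨A1, A2, -⟩ := hG.2 a b m K hab hma.symm hmb.symm haK hbK hmK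
    rcases hKM with ⟨h1, h2⟩ | ⟨h1, h2⟩ <;> rcases hK2 with h3 | h3 <;>
      rw [h1] at g1 <;> rw [h3] at g2 <;> rw [h2]
    · exact (A2.2 ⟨g1, g2⟩).1
    · exact (A1.1 ⟨g1, g2⟩).2
    · exact (A1.2 ⟨g2, g1⟩).1
    · exact (A2.1 ⟨g1, g2⟩).1
  rintro ⟨e, M'⟩ hs
  induction e using Sym2.ind with
  | _ a b =>
    have hab : a ≠ b := by
      have := hs.1.1
      simpa using this
    have ha : a ∉ M' := hs.1.2 a (by simp)
    have hb : b ∉ M' := hs.1.2 b (by simp)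
    have h0 := (mem_CIS hS hab ha hb).1 hs
    obtain ⟨hPab, hagree⟩ := h a b M' hab ha hb h0
    obtain ⟨hna, hnb⟩ := hnot a b hPab
    by_cases hM : κ s(a, b) = M'
    · rw [← hM]; exact hPG _ hPab
    · have : ∃ m, ¬ (m ∈ κ s(a, b) ↔ m ∈ M') := by
        by_contra! h'
        exact hM (Finset.ext h')
      obtain ⟨m, hm⟩ := this
      have hma : m ≠ a := by rintro rfl; simp [hna, ha] at hm
      have hmb : m ≠ b := by rintro rfl; simp [hnb, hb] at hm
      by_cases h1 : s(a, m) ∈ P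
      · exact core a b m M' hab ha hb h0 hma hmb hPab h1 hm
      by_cases h2 : s(b, m) ∈ P
      · rw [Sym2.eq_swap]
        rw [Sym2.eq_swap] at hPab hm
        exact core b a m M' hab.symm hb ha (by rw [apminor_symm hS]; exact h0) hmb hma hPab h2 hm
      exact absurd (hagree m hma hmb h1 h2) hm

lemma finish_C [Fintype N] {G : Set (CIStmt N)} (hG : IsGaussoid G) {i j m : N} {M : Finset N}
    (hij : i ≠ j) (him : i ≠ m) (hjm : j ≠ m) (hi : i ∉ M) (hj : j ∉ M) (hm : m ∉ M)
    (h1 : ((s(i, j), M) : CIStmt N) ∈ G) (h2 : ((s(i, m), M) : CIStmt N) ∈ G) :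
    ∃ S : Matrix N N ℝ, S.IsSymm ∧ PosDefMinors S ∧ ((s(i, j), M) : CIStmt N) ∈ CIS S ∧
      ((s(i, j), insert m M) : CIStmt N) ∈ CIS S ∧ CIS S ⊆ G := by
  obtain ⟨S, hS, hpd, hmem, hsub⟩ := finish_A {s(i, j), s(i, m)} (fun _ => M) (by
    intro e he
    simp only [Finset.mem_insert, Finset.mem_singleton] at he
    rcases he with rfl | rfl
    exacts [hG.1 _ h1, hG.1 _ h2]) Finset.card_le_two hG (by
    intro e he
    simp only [Finset.mem_insert, Finset.mem_singleton] at he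
    rcases he with rfl | rfl
    exacts [h1, h2])
  have g1 := hmem s(i, j) (by simp)
  have g2 := hmem s(i, m) (by simp)
  refine ⟨S, hS, hpd, g1, ?_, hsub⟩
  rw [mem_CIS hS hij (by simp [him, hi]) (by simp [hjm, hj])]
  rw [mem_CIS hS hij hi hj] at g1
  rw [mem_CIS hS him hi hm] at g2
  exact (face hpd hjm hj hm g1).2 (Or.inl g2)

lemma finish_B [Fintype N] {G : Set (CIStmt N)} (hG : IsGaussoid G) {i j m0 : N}
    {K M : Finset N} (h1 : ((s(i, j), K) : CIStmt N) ∈ G) (h2 : ((s(i, j), M) : CIStmt N) ∈ G)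
    (hm0 : m0 ∈ K) (hm0' : m0 ∉ M) :
    ∃ S : Matrix N N ℝ, S.IsSymm ∧ PosDefMinors S ∧ ((s(i, j), K) : CIStmt N) ∈ CIS S ∧
      ((s(i, j), M) : CIStmt N) ∈ CIS S ∧ CIS S ⊆ G := by
  have hp1 := hG.1 _ h1
  have hp2 := hG.1 _ h2
  have hij : i ≠ j := by
    have := hp1.1
    simpa using this
  have hiK : i ∉ K := hp1.2 i (by simp)
  have hjK : j ∉ K := hp1.2 j (by simp)
  have hiM : i ∉ M := hp2.2 i (by simp)
  have hjM : j ∉ M := hp2.2 j (by simp)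
  have hm0i : i ≠ m0 := by rintro rfl; exact hiK hm0
  have hm0j : j ≠ m0 := by rintro rfl; exact hjK hm0
  by_cases hex : ∃ m1, m1 ≠ m0 ∧ ¬ (m1 ∈ K ↔ m1 ∈ M)
  · obtain ⟨m1, hm1, hm1'⟩ := hex
    obtain ⟨S, hS, hpd, hK0, hM0, h⟩ := realize_B hij hiK hjK hiM hjM hm0 hm0' hm1 hm1'
    refine ⟨S, hS, hpd, (mem_CIS hS hij hiK hjK).2 hK0, (mem_CIS hS hij hiM hjM).2 hM0, ?_⟩
    rintro ⟨e, M'⟩ hs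
    induction e using Sym2.ind with
    | _ a b =>
      have hab : a ≠ b := by
        have := hs.1.1
        simpa using this
      have ha : a ∉ M' := hs.1.2 a (by simp)
      have hb : b ∉ M' := hs.1.2 b (by simp)
      obtain ⟨he, hM'⟩ := h a b M' hab ha hb ((mem_CIS hS hab ha hb).1 hs)
      rw [he]
      rcases hM' with rfl | rfl
      exacts [h1, h2]
  · push Not at hex
    have hK : K = insert m0 M := by
      ext n
      by_cases hn : n = m0
      · subst hn; simp [hm0]
      · simp [hn, hex n hn]
    subst hK
    rcases (hG.2 i j m0 M hij hm0i hm0j hiM hjM hm0').2.2 ⟨h2, h1⟩ with h | h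
    · obtain ⟨S, hS, hpd, c1, c2, hsub⟩ := finish_C hG hij hm0i hm0j hiM hjM hm0' h2 h
      exact ⟨S, hS, hpd, c2, c1, hsub⟩
    · rw [Sym2.eq_swap] at h1 h2 ⊢
      obtain ⟨S, hS, hpd, c1, c2, hsub⟩ := finish_C hG hij.symm hm0j hm0i hjM hiM hm0' h2 h
      exact ⟨S, hS, hpd, c2, c1, hsub⟩

lemma finish_two [Fintype N] {G : Set (CIStmt N)} (hG : IsGaussoid G) (s t : CIStmt N)
    (hs : s ∈ G) (ht : t ∈ G) :
    ∃ S : Matrix N N ℝ, S.IsSymm ∧ PosDefMinors S ∧ s ∈ CIS S ∧ t ∈ CIS S ∧ CIS S ⊆ G := by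
  obtain ⟨e, K⟩ := s
  obtain ⟨f, M⟩ := t
  by_cases hef : e = f
  · subst hef
    by_cases hKM : K = M
    · subst hKM
      obtain ⟨S, hS, hpd, hmem, hsub⟩ := finish_A {e} (fun _ => K)
        (by intro g hg; rw [Finset.mem_singleton.1 hg]; exact hG.1 _ hs) (by simp) hG
        (by intro g hg; rw [Finset.mem_singleton.1 hg]; exact hs)
      exact ⟨S, hS, hpd, hmem e (by simp), hmem e (by simp), hsub⟩
    · induction e using Sym2.ind with
      | _ i j =>
        have : ∃ m, ¬ (m ∈ K ↔ m ∈ M) := by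
          by_contra! h'
          exact hKM (Finset.ext h')
        obtain ⟨m, hm⟩ := this
        by_cases hmK : m ∈ K
        · exact finish_B hG hs ht hmK (by tauto)
        · obtain ⟨S, hS, hpd, c1, c2, hsub⟩ := finish_B hG ht hs (m0 := m) (by tauto) hmK
          exact ⟨S, hS, hpd, c2, c1, hsub⟩
  · have key : ∀ (p : CIStmt N → Prop), p (e, K) → p (f, M) →
        ∀ g ∈ ({e, f} : Finset (Sym2 N)), p (g, if g = e then K else M) := by
      intro p h1 h2 g hg
      simp only [Finset.mem_insert, Finset.mem_singleton] at hg
      rcases hg with rfl | rfl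
      · simpa using h1
      · simpa [Ne.symm hef] using h2
    obtain ⟨S, hS, hpd, hmem, hsub⟩ := finish_A {e, f} (fun g => if g = e then K else M)
      (key _ (hG.1 _ hs) (hG.1 _ ht)) Finset.card_le_two hG (key (· ∈ G) hs ht)
    have g1 := hmem e (by simp)
    have g2 := hmem f (by simp)
    simp only [if_true, Ne.symm hef, if_false] at g1 g2
    exact ⟨S, hS, hpd, g1, g2, hsub⟩

end helpers

/-- every CI inference rule with at most two antecedents that is valid for
all regular (positive-definite) real Gaussian CI structures is valid for all gaussoids. -/
theorem stmt1 {N : Type*} [Fintype N] [DecidableEq N]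
    (L M : Set (CIStmt N))
    (hLproper : ∀ s ∈ L, s.proper) (hMproper : ∀ s ∈ M, s.proper)
    (hLcard : L.encard ≤ 2)
    (hvalid : ∀ Sig : Matrix N N ℝ, Sig.IsSymm → PosDefMinors Sig →
      L ⊆ CIS Sig → (CIS Sig ∩ M).Nonempty) :
    ∀ G : Set (CIStmt N), IsGaussoid G → L ⊆ G → (G ∩ M).Nonempty := by
  intro G hG hLG
  suffices h : ∃ S : Matrix N N ℝ, S.IsSymm ∧ PosDefMinors S ∧ L ⊆ CIS S ∧ CIS S ⊆ G by
    obtain ⟨S, hS, hpd, h1, h2⟩ := h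
    obtain ⟨s, hs1, hs2⟩ := hvalid S hS hpd h1
    exact ⟨s, h2 hs1, hs2⟩
  rcases L.eq_empty_or_nonempty with rfl | ⟨s, hs⟩
  · obtain ⟨S, hS, hpd, -, hsub⟩ := finish_A ∅ (fun _ => (∅ : Finset N)) (by simp) (by simp) hG
      (by simp)
    exact ⟨S, hS, hpd, by simp, hsub⟩
  · have : ∃ t ∈ L, L ⊆ {s, t} := by
      by_cases h : ∃ t ∈ L, t ≠ s
      · obtain ⟨t, ht, hts⟩ := h
        refine ⟨t, ht, ?_⟩
        intro u hu
        by_contra hne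
        simp only [Set.mem_insert_iff, Set.mem_singleton_iff, not_or] at hne
        have hsub : ({u, s, t} : Set (CIStmt N)) ⊆ L := by
          rintro w (rfl | rfl | rfl) <;> assumption
        have h3 : ({u, s, t} : Set (CIStmt N)).encard = 3 :=
          Set.encard_eq_three.2 ⟨u, s, t, hne.1, hne.2, hts.symm, rfl⟩
        have := (Set.encard_le_encard hsub).trans hLcard
        rw [h3] at this
        exact absurd this (by norm_num)
      · push Not at h
        exact ⟨s, hs, fun u hu => by simp [h u hu]⟩
    obtain ⟨t, ht, hLst⟩ := this
    obtain ⟨S, hS, hpd, c1, c2, hsub⟩ := finish_two hG s t (hLG hs) (hLG ht)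
    refine ⟨S, hS, hpd, fun u hu => ?_, hsub⟩
    rcases hLst hu with rfl | rfl
    exacts [c1, c2]
end
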